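/- Let K ⊂ ℝ³ be a convex body and α > 0. Suppose there is an outward function Ψ : bd K → S² such that for every p ∈ bd K there are two planes H₁, H₂ whose intersection H₁ ∩ H₂ is the line through p with direction Ψ(p), which form an angle at least α with each other, and such that bd K ∩ H₁ and bd K ∩ H₂ are ellipses. Then bd K is an ellipsoid. -/

import Mathlib

open scoped RealInnerProductSpace
open MeasureTheory

noncomputable section

/-- Euclidean 3-space. -/
abbrev E3 : Type := EuclideanSpace ℝ (Fin 3)

/-- The line through `p` with direction vector `v`. -/
def lineThrough (p v : E3) : Set E3 := {x : E3 | ∃ t : ℝ, x = p + t • v}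

/-- A line in `ℝ³`. -/
def IsLine (L : Set E3) : Prop := ∃ p v : E3, v ≠ 0 ∧ L = lineThrough p v

/-- A plane in `ℝ³` with prescribed unit normal `n`. -/
def IsPlaneWithNormal (H : Set E3) (n : E3) : Prop :=
  ‖n‖ = 1 ∧ ∃ c : ℝ, H = {x : E3 | ⟪n, x⟫ = c}

/-- A plane in `ℝ³`. -/
def IsPlane (H : Set E3) : Prop := ∃ n : E3, IsPlaneWithNormal H n

/-- The unit circle `{(cos t, sin t, 0)}` in the plane `z = 0`. -/
def unitCircle3 : Set E3 := {x : E3 | x 0 ^ 2 + x 1 ^ 2 = 1 ∧ x 2 = 0}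

/-- An ellipse in `ℝ³`: the image of the unit circle under an invertible affine map. -/
def IsEllipse (E : Set E3) : Prop := ∃ f : E3 ≃ᵃ[ℝ] E3, E = f '' unitCircle3

/-- An ellipsoid in `ℝ³`: the image of the unit sphere under an invertible affine map. -/
def IsEllipsoid (S : Set E3) : Prop := ∃ f : E3 ≃ᵃ[ℝ] E3, S = f '' Metric.sphere (0 : E3) 1

/-- A circle in `ℝ³`: the points of some plane at fixed positive distance from a
center lying in that plane. -/
def IsCircle (C : Set E3) : Prop :=
  ∃ (H : Set E3) (c : E3) (r : ℝ), IsPlane H ∧ c ∈ H ∧ 0 < r ∧ C = {x ∈ H | dist x c = r}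

/-- A sphere in `ℝ³`. -/
def IsSphere (S : Set E3) : Prop := ∃ (c : E3) (r : ℝ), 0 < r ∧ S = Metric.sphere c r

/-- A convex body: compact, convex, with nonempty interior. -/
def IsConvexBody (K : Set E3) : Prop := IsCompact K ∧ Convex ℝ K ∧ (interior K).Nonempty

/-- A line `L` is tangent to `bd K` if it meets `K` but not the interior of `K`. -/
def IsTangentLine (K L : Set E3) : Prop := (L ∩ K).Nonempty ∧ L ∩ interior K = ∅

/-- An outward function on the boundary of a convex body `K`. -/
def IsOutwardFunction (K : Set E3) (Ψ : E3 → E3) : Prop :=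
  ContinuousOn Ψ (frontier K) ∧
  ∀ p ∈ frontier K, ‖Ψ p‖ = 1 ∧
    ¬ IsTangentLine K (lineThrough p (Ψ p)) ∧
    (∀ t : ℝ, 0 < t → p + t • Ψ p ∉ K) ∧
    ∃ q ∈ frontier K, q ∉ lineThrough p (Ψ p) ∧
      (lineThrough p (Ψ p) ∩ lineThrough q (Ψ q) ∩ interior K).Nonempty

/-- `L` is a line parallel to the direction `u`. -/
def LineParallel (L : Set E3) (u : E3) : Prop := ∃ p : E3, L = lineThrough p u

/-- A system of lines: for every direction `u ∈ S²` exactly one member line parallel to `u`. -/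
def IsLineSystem (𝓛 : Set (Set E3)) : Prop :=
  (∀ L ∈ 𝓛, IsLine L) ∧ ∀ u : E3, ‖u‖ = 1 → ∃! L, L ∈ 𝓛 ∧ LineParallel L u

/-- A continuous system of lines: the map `δ` sending each direction `u ∈ S²` to the point
of `L_u` closest to the origin is continuous. -/
def IsContinuousLineSystem (𝓛 : Set (Set E3)) : Prop :=
  IsLineSystem 𝓛 ∧ ∃ δ : E3 → E3, ContinuousOn δ (Metric.sphere (0 : E3) 1) ∧
    ∀ u : E3, ‖u‖ = 1 → ∀ L ∈ 𝓛, LineParallel L u →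
      δ u ∈ L ∧ ∀ x ∈ L, ‖δ u‖ ≤ ‖x‖

/-- The center of a system of lines: points lying on at least two distinct lines. -/
def lineSystemCenter (𝓛 : Set (Set E3)) : Set E3 :=
  {x : E3 | ∃ L₁ ∈ 𝓛, ∃ L₂ ∈ 𝓛, L₁ ≠ L₂ ∧ x ∈ L₁ ∧ x ∈ L₂}

/-- A smooth convex body: each boundary point has a unique (unit outer normal of a)
support plane. -/
def IsSmoothBody (K : Set E3) : Prop :=
  ∀ p ∈ frontier K, ∃! n : E3, ‖n‖ = 1 ∧ ∀ x ∈ K, ⟪n, x⟫ ≤ ⟪n, p⟫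

/-- A strictly convex body: the boundary contains no line segment. -/
def IsStrictlyConvexBody (K : Set E3) : Prop :=
  ∀ x ∈ frontier K, ∀ y ∈ frontier K, x ≠ y → ¬ segment ℝ x y ⊆ frontier K

/-- `η` is an outer unit normal field of `K` on its boundary. -/
def IsOuterNormal (K : Set E3) (η : E3 → E3) : Prop :=
  ∀ p ∈ frontier K, ‖η p‖ = 1 ∧ ∀ x ∈ K, ⟪η p, x⟫ ≤ ⟪η p, p⟫

/-- The boundary of `K` is a `C^k` surface: locally, after a rigid motion, it is the graph
of a `C^k` function of two variables. -/
def HasContDiffBoundary (K : Set E3) (k : ℕ) : Prop :=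
  ∀ p ∈ frontier K, ∃ (e : E3 ≃ᵃⁱ[ℝ] E3) (g : ℝ × ℝ → ℝ) (U : Set E3),
    IsOpen U ∧ p ∈ U ∧ ContDiff ℝ k g ∧
    frontier K ∩ U = {x ∈ U | e x 2 = g (e x 0, e x 1)}

end

noncomputable section

open Filter Topology

/-! ### The cross product on `E3` -/

/-- The cross product. -/
def cr (u v : E3) : E3 :=
  !₂[u 1 * v 2 - u 2 * v 1, u 2 * v 0 - u 0 * v 2, u 0 * v 1 - u 1 * v 0]

theorem inner_E3 (u v : E3) : ⟪u, v⟫ = u 0 * v 0 + u 1 * v 1 + u 2 * v 2 := by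
  rw [PiLp.inner_apply, Fin.sum_univ_three]
  simp [mul_comm]

@[simp] theorem cr_zero (u v : E3) : cr u v 0 = u 1 * v 2 - u 2 * v 1 := by simp [cr]
@[simp] theorem cr_one (u v : E3) : cr u v 1 = u 2 * v 0 - u 0 * v 2 := by simp [cr]
@[simp] theorem cr_two (u v : E3) : cr u v 2 = u 0 * v 1 - u 1 * v 0 := by simp [cr]

theorem ext_E3 {u v : E3} (h0 : u 0 = v 0) (h1 : u 1 = v 1) (h2 : u 2 = v 2) : u = v := by
  ext i; fin_cases i <;> assumption

theorem continuous_cr : Continuous (fun z : E3 × E3 => cr z.1 z.2) := by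
  unfold cr
  fun_prop

theorem Filter.Tendsto.cr {ι : Type*} {l : Filter ι} {u v : ι → E3} {a b : E3}
    (hu : Tendsto u l (𝓝 a)) (hv : Tendsto v l (𝓝 b)) :
    Tendsto (fun i => _root_.cr (u i) (v i)) l (𝓝 (_root_.cr a b)) :=
  (continuous_cr.tendsto (a, b)).comp (hu.prodMk_nhds hv)

theorem inner_cr_left (u v : E3) : ⟪u, cr u v⟫ = 0 := by
  simp only [inner_E3, cr_zero, cr_one, cr_two]; ring

theorem inner_cr_right (u v : E3) : ⟪v, cr u v⟫ = 0 := by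
  simp only [inner_E3, cr_zero, cr_one, cr_two]; ring

theorem inner_cr_cr (a b c d : E3) :
    ⟪cr a b, cr c d⟫ = ⟪a, c⟫ * ⟪b, d⟫ - ⟪a, d⟫ * ⟪b, c⟫ := by
  simp only [inner_E3, cr_zero, cr_one, cr_two]; ring

theorem cr_cr (a b c : E3) : cr a (cr b c) = ⟪a, c⟫ • b - ⟪a, b⟫ • c := by
  apply ext_E3 <;> simp [inner_E3] <;> ring

theorem inner_cr_cyclic (a b c : E3) : ⟪a, cr b c⟫ = ⟪b, cr c a⟫ := by
  simp only [inner_E3, cr_zero, cr_one, cr_two]; ring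

theorem cr_anticomm (a b : E3) : cr a b = -cr b a := by
  apply ext_E3 <;> simp <;> ring

/-- Cramer's rule. -/
theorem cramer (a b c y : E3) :
    ⟪a, cr b c⟫ • y = ⟪y, cr b c⟫ • a + ⟪y, cr c a⟫ • b + ⟪y, cr a b⟫ • c := by
  apply ext_E3 <;> simp [inner_E3] <;> ring

theorem inner_self_one {u : E3} (h : ‖u‖ = 1) : ⟪u, u⟫ = 1 := by
  rw [real_inner_self_eq_norm_sq, h]; norm_num

/-- Expansion in the orthonormal basis `u, m, u × m`. -/
theorem frame_expand {u m : E3} (hu : ‖u‖ = 1) (hm : ‖m‖ = 1) (hum : ⟪m, u⟫ = 0) (y : E3) :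
    y = ⟪y, u⟫ • u + ⟪y, m⟫ • m + ⟪y, cr u m⟫ • cr u m := by
  have h := cramer u m (cr u m) y
  have e : cr (cr u m) u = m := by
    rw [cr_anticomm, cr_cr, inner_self_one hu, real_inner_comm, hum]; simp
  rw [cr_cr, e, real_inner_comm, hum] at h
  rw [inner_self_one hm, zero_smul, sub_zero, one_smul, inner_self_one hu, one_smul] at h
  exact h

theorem norm_cr {u m : E3} (hu : ‖u‖ = 1) (hm : ‖m‖ = 1) (hum : ⟪m, u⟫ = 0) : ‖cr u m‖ = 1 := by
  have : ‖cr u m‖ ^ 2 = 1 := by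
    rw [← real_inner_self_eq_norm_sq, inner_cr_cr, inner_self_one hu, inner_self_one hm, hum]
    ring
  nlinarith [norm_nonneg (cr u m)]

/-- Two unit vectors with vanishing cross product agree up to sign. -/
theorem eq_or_neg_of_cr {a b : E3} (ha : ‖a‖ = 1) (hb : ‖b‖ = 1) (h : cr a b = 0) :
    a = b ∨ a = -b := by
  have h1 : ⟪a, b⟫ ^ 2 = 1 := by
    have := inner_cr_cr a b a b
    rw [h, inner_zero_left, inner_self_one ha, inner_self_one hb, real_inner_comm a b] at this
    linarith
  have h2 := cr_cr a a b
  rw [h, inner_self_one ha] at h2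
  have h3 : b = ⟪a, b⟫ • a := by
    have : cr a (0 : E3) = 0 := by apply ext_E3 <;> simp
    rw [this, one_smul] at h2
    exact (sub_eq_zero.1 h2.symm).symm
  rcases sq_eq_one_iff.1 h1 with h4 | h4 <;> rw [h4] at h3
  · left; simpa using h3.symm
  · right; simp at h3; rw [h3]; simp

/-! ### Convex bodies: rays and boundary points -/

/-- A segment from a point of `K` to a point outside `K` meets the boundary. -/
theorem exists_frontier_segment {K : Set E3} {x d : E3} {a b : ℝ} (hab : a ≤ b)
    (ha : x + a • d ∈ K) (hb : x + b • d ∉ K) :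
    ∃ r ∈ Set.Icc a b, x + r • d ∈ frontier K := by
  have hp : IsPreconnected ((fun r : ℝ => x + r • d) '' Set.Icc a b) :=
    isPreconnected_Icc.image _ (by fun_prop)
  by_contra! hc
  have hc' : ∀ y ∈ (fun r : ℝ => x + r • d) '' Set.Icc a b, y ∈ closure K → y ∈ interior K := by
    rintro _ ⟨r, hr, rfl⟩ h
    by_contra h'
    exact hc r hr ⟨h, h'⟩
  obtain ⟨y, -, h1, h2⟩ := hp (interior K) (closure K)ᶜ isOpen_interior
    isClosed_closure.isOpen_compl
    (fun y hy => by by_cases h : y ∈ closure K; exacts [Or.inl (hc' y hy h), Or.inr h])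
    ⟨_, ⟨a, Set.left_mem_Icc.2 hab, rfl⟩,
      hc' _ ⟨a, Set.left_mem_Icc.2 hab, rfl⟩ (subset_closure ha)⟩
    ⟨_, ⟨b, Set.right_mem_Icc.2 hab, rfl⟩, fun h => hb (interior_subset
      (hc' _ ⟨b, Set.right_mem_Icc.2 hab, rfl⟩ h))⟩
  exact h2 (subset_closure (interior_subset h1))

theorem not_mem_interior_of_frontier {K : Set E3} {y : E3} (hy : y ∈ frontier K) :
    y ∉ interior K := fun h => hy.2 h

theorem frontier_subset {K : Set E3} (hK : IsConvexBody K) {y : E3} (hy : y ∈ frontier K) :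
    y ∈ K := hK.1.isClosed.frontier_subset hy

/-- Every ray from an interior point meets the boundary. -/
theorem exists_ray_frontier {K : Set E3} (hK : IsConvexBody K) {x d : E3}
    (hx : x ∈ interior K) (hd : d ≠ 0) : ∃ r : ℝ, 0 < r ∧ x + r • d ∈ frontier K := by
  obtain ⟨R, hR⟩ := hK.1.isBounded.exists_norm_le
  have hd' : 0 < ‖d‖ := norm_pos_iff.2 hd
  have hR0 : 0 ≤ R := (norm_nonneg x).trans (hR x (interior_subset hx))
  obtain ⟨r, hr, h⟩ := exists_frontier_segment (K := K) (x := x) (d := d)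
    (a := 0) (b := (R + ‖x‖ + 1) / ‖d‖) (by positivity) (by simpa using interior_subset hx) (by
      intro h
      have h1 := hR _ h
      have h2 := norm_sub_le (x + ((R + ‖x‖ + 1) / ‖d‖) • d) x
      rw [add_sub_cancel_left, norm_smul, Real.norm_of_nonneg (by positivity),
        div_mul_cancel₀ _ hd'.ne'] at h2
      linarith)
  refine ⟨r, lt_of_le_of_ne hr.1 ?_, h⟩
  rintro rfl
  rw [zero_smul, add_zero] at h
  exact h.2 hx

theorem interior_of_lt_one {K : Set E3} (hK : IsConvexBody K) {x w : E3} {r : ℝ}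
    (hx : x ∈ interior K) (hy : x + w ∈ K) (h0 : 0 ≤ r) (h1 : r < 1) :
    x + r • w ∈ interior K := by
  have := hK.2.1.combo_interior_self_mem_interior hx hy (sub_pos.2 h1) h0 (by ring)
  convert this using 1
  module

theorem not_mem_of_one_lt {K : Set E3} (hK : IsConvexBody K) {x w : E3} {r : ℝ}
    (hx : x ∈ interior K) (hy : x + w ∈ frontier K) (h1 : 1 < r) : x + r • w ∉ K := by
  intro h
  have := interior_of_lt_one hK hx h (r := r⁻¹) (by positivity) (inv_lt_one_of_one_lt₀ h1)
  rw [smul_smul, inv_mul_cancel₀ (by positivity), one_smul] at this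
  exact hy.2 this

/-- A line through an interior point meets the boundary in two points on opposite sides. -/
theorem exists_two_frontier {K : Set E3} (hK : IsConvexBody K) {x d : E3}
    (hx : x ∈ interior K) (hd : d ≠ 0) : ∃ r s : ℝ, 0 < r ∧ s < 0 ∧
      x + r • d ∈ frontier K ∧ x + s • d ∈ frontier K := by
  obtain ⟨r, hr, h⟩ := exists_ray_frontier hK hx hd
  obtain ⟨s, hs, h'⟩ := exists_ray_frontier hK hx (neg_ne_zero.2 hd)
  exact ⟨r, -s, hr, by linarith, h, by simpa using h'⟩

/-! ### Quadratic functions -/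

/-- Quadratic (polynomial of degree at most two) functions on `E3`. -/
def IsQuad (f : E3 → ℝ) : Prop :=
  ∃ (B : E3 →L[ℝ] E3 →L[ℝ] ℝ) (l : E3 →L[ℝ] ℝ) (c : ℝ), ∀ y, f y = B y y + l y + c

/-- The general polynomial of degree at most two in two variables. -/
def quad (c : Fin 6 → ℝ) (t s : ℝ) : ℝ :=
  c 0 * t ^ 2 + c 1 * (t * s) + c 2 * s ^ 2 + c 3 * t + c 4 * s + c 5

theorem IsQuad.continuous {f : E3 → ℝ} (hf : IsQuad f) : Continuous f := by
  obtain ⟨B, l, c, h⟩ := hf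
  rw [funext h]
  fun_prop

theorem IsQuad.add {f g : E3 → ℝ} (hf : IsQuad f) (hg : IsQuad g) :
    IsQuad (fun y => f y + g y) := by
  obtain ⟨B, l, c, h⟩ := hf
  obtain ⟨B', l', c', h'⟩ := hg
  refine ⟨B + B', l + l', c + c', fun y => ?_⟩
  simp [h, h']; ring

theorem IsQuad.const_mul {f : E3 → ℝ} (a : ℝ) (hf : IsQuad f) : IsQuad (fun y => a * f y) := by
  obtain ⟨B, l, c, h⟩ := hf
  refine ⟨a • B, a • l, a * c, fun y => ?_⟩
  simp [h]; ring

theorem isQuad_mul (l₁ l₂ : E3 →L[ℝ] ℝ) (c₁ c₂ : ℝ) :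
    IsQuad (fun y => (l₁ y + c₁) * (l₂ y + c₂)) := by
  refine ⟨l₁.smulRight l₂, c₂ • l₁ + c₁ • l₂, c₁ * c₂, fun y => ?_⟩
  simp; ring

theorem isQuad_affine (l : E3 →L[ℝ] ℝ) (c : ℝ) : IsQuad (fun y => l y + c) :=
  ⟨0, l, c, fun y => by simp⟩

theorem isQuad_const (c : ℝ) : IsQuad (fun _ => c) :=
  ⟨0, 0, c, fun y => by simp⟩

theorem isQuad_quad (c : Fin 6 → ℝ) (l₁ l₂ : E3 →L[ℝ] ℝ) (c₁ c₂ : ℝ) :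
    IsQuad (fun y => quad c (l₁ y + c₁) (l₂ y + c₂)) := by
  have := (((((isQuad_mul l₁ l₁ c₁ c₁).const_mul (c 0)).add
    ((isQuad_mul l₁ l₂ c₁ c₂).const_mul (c 1))).add
    ((isQuad_mul l₂ l₂ c₂ c₂).const_mul (c 2))).add
    ((isQuad_affine l₁ c₁).const_mul (c 3))).add
    (((isQuad_affine l₂ c₂).const_mul (c 4)).add (isQuad_const (c 5)))
  convert this using 2 with y
  simp only [quad]; ring

theorem IsQuad.restrict {f : E3 → ℝ} (hf : IsQuad f) (p u v : E3) :
    ∃ c : Fin 6 → ℝ, ∀ t s : ℝ, f (p + t • u + s • v) = quad c t s := by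
  obtain ⟨B, l, c, h⟩ := hf
  refine ⟨![B u u, B u v + B v u, B v v, B p u + B u p + l u, B p v + B v p + l v,
    B p p + l p + c], fun t s => ?_⟩
  simp only [h, quad, map_add, map_smul, add_apply, smul_apply, smul_eq_mul, Matrix.cons_val]
  ring

/-- A quadratic function restricted to a line. -/
theorem IsQuad.line {f : E3 → ℝ} (hf : IsQuad f) (x : E3) :
    ∃ (B : E3 →L[ℝ] E3 →L[ℝ] ℝ) (l : E3 →L[ℝ] ℝ), ∀ w, f (x + w) = B w w + l w + f x := by
  obtain ⟨B, l, c, h⟩ := hf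
  refine ⟨B, l + B x + B.flip x, fun w => ?_⟩
  simp [h]; ring

/-- A conic meeting the unit circle in five points contains it. -/
theorem quad_circle_five {c : Fin 6 → ℝ} {z : Fin 5 → ℝ × ℝ} (hz : Function.Injective z)
    (h1 : ∀ i, (z i).1 ^ 2 + (z i).2 ^ 2 = 1) (h0 : ∀ i, quad c (z i).1 (z i).2 = 0)
    {u v : ℝ} (huv : u ^ 2 + v ^ 2 = 1) : quad c u v = 0 := by
  have key : ∀ u v : ℝ, u ^ 2 + v ^ 2 = 1 → ∀ w : ℂ, w = u + v * Complex.I →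
      w ^ 2 * (quad c u v : ℂ) =
      ((c 0 - c 2) / 4 - c 1 / 4 * Complex.I) * w ^ 4 + (c 3 / 2 - c 4 / 2 * Complex.I) * w ^ 3
        + ((c 0 + c 2) / 2 + c 5) * w ^ 2 + (c 3 / 2 + c 4 / 2 * Complex.I) * w
        + ((c 0 - c 2) / 4 + c 1 / 4 * Complex.I) := by
    intro u v h w hw
    set w' : ℂ := u - v * Complex.I with hw'
    have hI := Complex.I_sq
    have hC : (u : ℂ) ^ 2 + (v : ℂ) ^ 2 = 1 := by exact_mod_cast h
    have hww : w * w' = 1 := by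
      rw [hw, hw']; linear_combination hC - (v : ℂ) ^ 2 * hI
    have hu : w * u = (w ^ 2 + 1) / 2 := by
      linear_combination (1 / 2 : ℂ) * hww + w * (-1 / 2) * (hw + hw')
    have hv : w * v = -Complex.I * (w ^ 2 - 1) / 2 := by
      linear_combination (-Complex.I / 2) * (-hww) + w * (Complex.I / 2) * (hw - hw')
        + (v : ℂ) * w * hI
    simp only [quad]
    push_cast
    linear_combination (c 0 * (w * u + (w ^ 2 + 1) / 2) + c 1 * (w * v) + c 3 * w : ℂ) * hu
      + (c 1 * ((w ^ 2 + 1) / 2) + c 2 * (w * v - Complex.I * (w ^ 2 - 1) / 2) + c 4 * w : ℂ) * hv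
      + (c 2 * (w ^ 2 - 1) ^ 2 / 4 : ℂ) * hI
  set P : Polynomial ℂ :=
    Polynomial.C ((c 0 - c 2) / 4 - c 1 / 4 * Complex.I : ℂ) * Polynomial.X ^ 4
      + Polynomial.C (c 3 / 2 - c 4 / 2 * Complex.I : ℂ) * Polynomial.X ^ 3
      + Polynomial.C ((c 0 + c 2) / 2 + c 5 : ℂ) * Polynomial.X ^ 2
      + Polynomial.C (c 3 / 2 + c 4 / 2 * Complex.I : ℂ) * Polynomial.X
      + Polynomial.C ((c 0 - c 2) / 4 + c 1 / 4 * Complex.I : ℂ) with hP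
  have hev : ∀ u v : ℝ, u ^ 2 + v ^ 2 = 1 →
      P.eval (u + v * Complex.I) = (u + v * Complex.I) ^ 2 * (quad c u v : ℂ) := by
    intro u v h
    rw [key u v h _ rfl]
    simp [hP]
  have hP0 : P = 0 := by
    refine Polynomial.eq_zero_of_natDegree_lt_card_of_eval_eq_zero P
      (f := fun i => ((z i).1 + (z i).2 * Complex.I : ℂ)) ?_ ?_ ?_
    · intro i j hij
      apply hz
      have h1 := congrArg Complex.re hij
      have h2 := congrArg Complex.im hij
      simp at h1 h2
      exact Prod.ext h1 h2
    · intro i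
      rw [hev _ _ (h1 i), h0 i]; simp
    · have : P.natDegree ≤ 4 := by rw [hP]; compute_degree
      simpa using Nat.lt_succ_of_le this
  have h2 := hev u v huv
  rw [hP0, Polynomial.eval_zero] at h2
  have hne : (u + v * Complex.I : ℂ) ≠ 0 := by
    intro h
    have h3 := congrArg Complex.re h
    have h4 := congrArg Complex.im h
    simp at h3 h4
    rw [h3, h4] at huv
    norm_num at huv
  rcases mul_eq_zero.1 h2.symm with h | h
  · exact absurd h (pow_ne_zero 2 hne)
  · exact_mod_cast h

/-- A conic vanishing on an arc of the unit circle contains it. -/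
theorem quad_circle_arc {c : Fin 6 → ℝ} {t₀ : ℝ}
    (h : ∀ᶠ t in 𝓝 t₀, quad c (Real.cos t) (Real.sin t) = 0) (t : ℝ) :
    quad c (Real.cos t) (Real.sin t) = 0 := by
  have ha : AnalyticOnNhd ℝ (fun t => quad c (Real.cos t) (Real.sin t)) Set.univ := by
    intro t _
    unfold quad
    fun_prop
  exact ha.eqOn_of_preconnected_of_eventuallyEq (analyticOnNhd_const (v := (0 : ℝ)))
    isPreconnected_univ (Set.mem_univ t₀) h (Set.mem_univ t)

/-! ### Ellipses -/

theorem affine_apply (F : E3 ≃ᵃ[ℝ] E3) (z : E3) : F z = F 0 + F.linear z := by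
  have := F.map_vadd 0 z
  simpa [add_comm] using this

/-- Parametrization and equation of an ellipse. -/
theorem IsEllipse.exists_param {E : Set E3} (hE : IsEllipse E) :
    ∃ o a b : E3, (∀ u v : ℝ, u ^ 2 + v ^ 2 = 1 → o + u • a + v • b ∈ E) ∧
      (∀ y ∈ E, ∃ u v : ℝ, u ^ 2 + v ^ 2 = 1 ∧ y = o + u • a + v • b) ∧
      (∀ u v : ℝ, u • a + v • b = 0 → u = 0 ∧ v = 0) ∧
      ∃ e : E3 → ℝ, IsQuad e ∧ e o = -1 ∧ ∀ y ∈ E, e y = 0 := by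
  obtain ⟨F, rfl⟩ := hE
  have hlin : ∀ u v : ℝ, F.linear !₂[u, v, 0] = u • F.linear !₂[1, 0, 0]
      + v • F.linear !₂[0, 1, 0] := by
    intro u v
    rw [← map_smul, ← map_smul, ← map_add]
    congr 1
    apply ext_E3 <;> simp
  refine ⟨F 0, F.linear !₂[1, 0, 0], F.linear !₂[0, 1, 0], ?_, ?_, ?_, ?_⟩
  · intro u v h
    refine ⟨!₂[u, v, 0], ⟨by simpa using h, by simp⟩, ?_⟩
    rw [affine_apply, hlin, add_assoc]
  · rintro _ ⟨z, ⟨h1, h2⟩, rfl⟩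
    refine ⟨z 0, z 1, h1, ?_⟩
    have : z = !₂[z 0, z 1, 0] := by apply ext_E3 <;> simp [h2]
    rw [affine_apply, add_assoc, ← hlin, ← this]
  · intro u v h
    rw [← hlin] at h
    have h' := F.linear.map_eq_zero_iff.1 h
    have h0 := congrArg (fun z : E3 => z 0) h'
    have h1 := congrArg (fun z : E3 => z 1) h'
    simp at h0 h1
    exact ⟨h0, h1⟩
  · set G := F.symm
    have hG : ∀ i : Fin 3, ∃ l : E3 →L[ℝ] ℝ, ∃ c : ℝ, ∀ y, G y i = l y + c := by
      intro i
      refine ⟨(EuclideanSpace.proj i).comp G.linear.toLinearMap.toContinuousLinearMap, G 0 i,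
        fun y => ?_⟩
      rw [affine_apply G y]
      simp [add_comm]
    obtain ⟨l₀, c₀, h₀⟩ := hG 0
    obtain ⟨l₁, c₁, h₁⟩ := hG 1
    refine ⟨fun y => G y 0 ^ 2 + G y 1 ^ 2 - 1, ?_, ?_, ?_⟩
    · have := ((isQuad_mul l₀ l₀ c₀ c₀).add (isQuad_mul l₁ l₁ c₁ c₁)).add (isQuad_const (-1))
      convert this using 2 with y
      rw [h₀, h₁]; ring
    · simp [G]
    · rintro _ ⟨z, ⟨h1, h2⟩, rfl⟩
      simp [G, h1]

theorem ellipse_five {E : Set E3} (hE : IsEllipse E) {f : E3 → ℝ} (hf : IsQuad f)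
    {y : Fin 5 → E3} (hy : Function.Injective y) (hyE : ∀ i, y i ∈ E) (h0 : ∀ i, f (y i) = 0)
    {w : E3} (hw : w ∈ E) : f w = 0 := by
  obtain ⟨o, a, b, -, h2, -, -⟩ := hE.exists_param
  obtain ⟨c, hc⟩ := hf.restrict o a b
  choose u v huv hyuv using fun i => h2 (y i) (hyE i)
  obtain ⟨u', v', h, rfl⟩ := h2 w hw
  rw [hc]
  refine quad_circle_five (z := fun i => (u i, v i)) ?_ huv ?_ h
  · intro i j hij
    simp only [Prod.mk.injEq] at hij
    apply hy
    rw [hyuv i, hyuv j, hij.1, hij.2]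
  · intro i
    rw [← hc, ← hyuv, h0]

theorem ellipse_arc {E U : Set E3} (hE : IsEllipse E) {f : E3 → ℝ} (hf : IsQuad f)
    (hU : IsOpen U) {z : E3} (hz : z ∈ E) (hzU : z ∈ U) (h0 : ∀ y ∈ E ∩ U, f y = 0)
    {w : E3} (hw : w ∈ E) : f w = 0 := by
  obtain ⟨o, a, b, h1, h2, -, -⟩ := hE.exists_param
  obtain ⟨c, hc⟩ := hf.restrict o a b
  have hang : ∀ u v : ℝ, u ^ 2 + v ^ 2 = 1 → ∃ t, u = Real.cos t ∧ v = Real.sin t := by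
    intro u v h
    have hn : ‖(⟨u, v⟩ : ℂ)‖ = 1 := by
      rw [Complex.norm_def, Complex.normSq_mk, ← sq, ← sq, h, Real.sqrt_one]
    refine ⟨Complex.arg ⟨u, v⟩, ?_, ?_⟩
    · have := Complex.norm_mul_cos_arg ⟨u, v⟩
      rw [hn, one_mul] at this; exact this.symm
    · have := Complex.norm_mul_sin_arg ⟨u, v⟩
      rw [hn, one_mul] at this; exact this.symm
  obtain ⟨u, v, huv, rfl⟩ := h2 z hz
  obtain ⟨t₀, rfl, rfl⟩ := hang u v huv
  obtain ⟨u', v', huv', rfl⟩ := h2 w hw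
  obtain ⟨t, rfl, rfl⟩ := hang u' v' huv'
  rw [hc]
  refine quad_circle_arc (t₀ := t₀) ?_ t
  have hcont : Continuous fun t : ℝ => o + Real.cos t • a + Real.sin t • b := by fun_prop
  filter_upwards [(hU.preimage hcont).mem_nhds hzU] with t ht
  rw [← hc]
  exact h0 _ ⟨h1 _ _ (Real.cos_sq_add_sin_sq t), ht⟩

/-! ### Outward functions with elliptic sections -/

/-- The unit vector `n` is orthogonal to `Ψ p` and the section of `frontier K` by the plane
through `p` normal to `n` is an ellipse. -/
structure EllipticNormal (K : Set E3) (Ψ : E3 → E3) (p n : E3) : Prop where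
  norm : ‖n‖ = 1
  orth : ⟪n, Ψ p⟫ = 0
  ellipse : IsEllipse (frontier K ∩ {y | ⟪n, y - p⟫ = 0})

/-- The section of `frontier K` by the plane through `p` normal to `m` lies on a conic. -/
def ConicNormal (K : Set E3) (Ψ : E3 → E3) (p m : E3) : Prop :=
  ∃ c : Fin 6 → ℝ, c ≠ 0 ∧
    ∀ t s : ℝ, p + t • Ψ p + s • cr (Ψ p) m ∈ frontier K → quad c t s = 0

/-- The hypotheses on `K` and `Ψ`, with `κ` a bound for the cosines of the angles. -/
structure OutwardData (K : Set E3) (Ψ : E3 → E3) (κ : ℝ) : Prop where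
  body : IsConvexBody K
  cont : ContinuousOn Ψ (frontier K)
  norm : ∀ p ∈ frontier K, ‖Ψ p‖ = 1
  inner_mem : ∀ p ∈ frontier K, ∃ t : ℝ, t < 0 ∧ p + t • Ψ p ∈ interior K
  out : ∀ p ∈ frontier K, ∀ t : ℝ, 0 < t → p + t • Ψ p ∉ K
  cross : ∀ p ∈ frontier K, ∃ q ∈ frontier K, q ∉ lineThrough p (Ψ p) ∧
    ∃ t s : ℝ, p + t • Ψ p ∈ interior K ∧ p + t • Ψ p = q + s • Ψ q
  kappa : κ < 1
  planes : ∀ p ∈ frontier K, ∃ n₁ n₂ : E3, EllipticNormal K Ψ p n₁ ∧ EllipticNormal K Ψ p n₂ ∧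
    |⟪n₁, n₂⟫| ≤ κ

theorem elliptic_of_plane {K H : Set E3} {Ψ : E3 → E3} {p n : E3} (hH : IsPlaneWithNormal H n)
    (hL : lineThrough p (Ψ p) ⊆ H) (hE : IsEllipse (frontier K ∩ H)) :
    EllipticNormal K Ψ p n := by
  obtain ⟨h1, c, rfl⟩ := hH
  have hp : ⟪n, p⟫ = c := hL ⟨0, by simp⟩
  have hq : ⟪n, p + Ψ p⟫ = c := hL ⟨1, by simp⟩
  refine ⟨h1, by rw [inner_add_right] at hq; linarith, ?_⟩
  convert hE using 3 with y
  ext y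
  simp only [inner_sub_right, hp, sub_eq_zero]

theorem outwardData {K : Set E3} (hK : IsConvexBody K)
    {α : ℝ} (hα : 0 < α) {Ψ : E3 → E3} (hΨ : IsOutwardFunction K Ψ)
    (h : ∀ p ∈ frontier K, ∃ (H₁ H₂ : Set E3) (n₁ n₂ : E3),
      IsPlaneWithNormal H₁ n₁ ∧ IsPlaneWithNormal H₂ n₂ ∧
      H₁ ∩ H₂ = lineThrough p (Ψ p) ∧
      α ≤ Real.arccos |⟪n₁, n₂⟫| ∧
      IsEllipse (frontier K ∩ H₁) ∧ IsEllipse (frontier K ∩ H₂))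
    (hne : (frontier K).Nonempty) : OutwardData K Ψ (Real.cos α) := by
  have hpi : α ≤ Real.pi / 2 := by
    obtain ⟨p, hp⟩ := hne
    obtain ⟨H₁, H₂, n₁, n₂, -, -, -, ha, -, -⟩ := h p hp
    exact ha.trans (Real.arccos_le_pi_div_two.2 (abs_nonneg _))
  have hmem : ∀ p ∈ frontier K, ∀ t : ℝ, p + t • Ψ p ∈ interior K → t < 0 := by
    intro p hp t ht
    rcases lt_trichotomy t 0 with h | h | h
    · exact h
    · rw [h, zero_smul, add_zero] at ht
      exact absurd ht (not_mem_interior_of_frontier hp)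
    · exact absurd (interior_subset ht) ((hΨ.2 p hp).2.2.1 t h)
  refine ⟨hK, hΨ.1, fun p hp => (hΨ.2 p hp).1, ?_, fun p hp => (hΨ.2 p hp).2.2.1, ?_, ?_, ?_⟩
  · intro p hp
    have h1 := (hΨ.2 p hp).2.1
    have h2 : (lineThrough p (Ψ p) ∩ interior K).Nonempty := by
      by_contra h3
      exact h1 ⟨⟨p, ⟨0, by simp⟩, frontier_subset hK hp⟩, Set.not_nonempty_iff_eq_empty.1 h3⟩
    obtain ⟨_, ⟨t, rfl⟩, ht⟩ := h2
    exact ⟨t, hmem p hp t ht, ht⟩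
  · intro p hp
    obtain ⟨q, hq, hqL, _, ⟨⟨t, rfl⟩, s, hs⟩, hx⟩ := (hΨ.2 p hp).2.2.2
    exact ⟨q, hq, hqL, t, s, hx, hs⟩
  · rw [← Real.cos_zero]
    exact Real.cos_lt_cos_of_nonneg_of_le_pi_div_two le_rfl hpi hα
  · intro p hp
    obtain ⟨H₁, H₂, n₁, n₂, h1, h2, h12, ha, e1, e2⟩ := h p hp
    refine ⟨n₁, n₂, elliptic_of_plane h1 (h12 ▸ Set.inter_subset_left) e1,
      elliptic_of_plane h2 (h12 ▸ Set.inter_subset_right) e2, ?_⟩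
    have h3 : |⟪n₁, n₂⟫| ≤ 1 := by
      have := abs_real_inner_le_norm n₁ n₂
      rwa [h1.1, h2.1, one_mul] at this
    have h4 := Real.cos_le_cos_of_nonneg_of_le_pi hα.le (Real.arccos_le_pi _) ha
    rwa [Real.cos_arccos (by linarith [abs_nonneg ⟪n₁, n₂⟫]) h3] at h4

/-- Coordinates in the plane through `p` normal to `m`. -/
theorem plane_coords {u m p y : E3} (hu : ‖u‖ = 1) (hm : ‖m‖ = 1) (hum : ⟪m, u⟫ = 0)
    (hy : ⟪m, y - p⟫ = 0) : p + ⟪u, y - p⟫ • u + ⟪cr u m, y - p⟫ • cr u m = y := by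
  have h := frame_expand hu hm hum (y - p)
  rw [real_inner_comm, real_inner_comm m, hy, real_inner_comm (cr u m), zero_smul, add_zero] at h
  rw [add_assoc, ← h]; simp

theorem EllipticNormal.conic {K : Set E3} {Ψ : E3 → E3} {p n : E3} (hΨ : ‖Ψ p‖ = 1)
    (h : EllipticNormal K Ψ p n) : ConicNormal K Ψ p n := by
  obtain ⟨o, a, b, h1, -, -, e, he, heo, he0⟩ := h.ellipse.exists_param
  obtain ⟨c, hc⟩ := he.restrict p (Ψ p) (cr (Ψ p) n)
  refine ⟨c, ?_, fun t s hts => ?_⟩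
  · rintro rfl
    have i1 := (h1 1 0 (by norm_num)).2
    have i2 := (h1 (-1) 0 (by norm_num)).2
    have ho : ⟪n, o - p⟫ = 0 := by
      simp only [Set.mem_ofPred_eq, inner_sub_right, inner_add_right, inner_smul_right] at i1 i2 ⊢
      linarith
    have := plane_coords hΨ h.norm h.orth ho
    rw [← this, hc] at heo
    simp [quad] at heo
  · rw [← hc]
    refine he0 _ ⟨hts, ?_⟩
    simp only [Set.mem_ofPred_eq, add_assoc, add_sub_cancel_left, inner_add_right,
      inner_smul_right, h.orth, inner_cr_right, mul_zero, add_zero]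

theorem quad_smul (a : ℝ) (c : Fin 6 → ℝ) (t s : ℝ) : quad (a • c) t s = a * quad c t s := by
  simp [quad]; ring

/-- The set of conic normals is closed. -/
theorem ConicNormal.of_tendsto {K : Set E3} {Ψ : E3 → E3} {κ : ℝ} (D : OutwardData K Ψ κ)
    {p m : ℕ → E3} {p₀ m₀ : E3} (hp : ∀ n, p n ∈ frontier K) (hp₀ : p₀ ∈ frontier K)
    (hpt : Tendsto p atTop (𝓝 p₀)) (hmt : Tendsto m atTop (𝓝 m₀))
    (h : ∀ n, ConicNormal K Ψ (p n) (m n)) : ConicNormal K Ψ p₀ m₀ := by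
  choose c hc0 hc using h
  have hsph : ∀ n, ‖c n‖⁻¹ • c n ∈ Metric.sphere (0 : Fin 6 → ℝ) 1 := by
    intro n
    simp [norm_smul, inv_mul_cancel₀ (norm_ne_zero_iff.2 (hc0 n))]
  obtain ⟨c₀, hc₀, φ, hφ, hlim⟩ := (isCompact_sphere (0 : Fin 6 → ℝ) 1).tendsto_subseq hsph
  refine ⟨c₀, ?_, fun t s hts => ?_⟩
  · rintro rfl
    simp at hc₀
  by_contra hne
  obtain ⟨t₀, -, ht₀⟩ := D.inner_mem p₀ hp₀
  have hΨ : Tendsto (fun n => Ψ (p n)) atTop (𝓝 (Ψ p₀)) :=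
    (D.cont p₀ hp₀).tendsto.comp
      (tendsto_nhdsWithin_iff.2 ⟨hpt, Eventually.of_forall hp⟩)
  have hd := hΨ.cr hmt
  have hF : Continuous fun z : (Fin 6 → ℝ) × ℝ => quad z.1 (t₀ + z.2 * (t - t₀)) (z.2 * s) := by
    unfold quad; fun_prop
  have hev := hF.continuousAt.eventually_ne (x := (c₀, (1 : ℝ))) (y := 0) (by simpa using hne)
  obtain ⟨δ, hδ, hball⟩ := Metric.eventually_nhds_iff.1 hev
  set ε := min (δ / 2) (1 / 2) with hε
  have hε0 : 0 < ε := by positivity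
  have hε1 : ε ≤ 1 / 2 := min_le_right _ _
  have hεδ : ε ≤ δ / 2 := min_le_left _ _
  have hx : p₀ + t₀ • Ψ p₀ + ((t - t₀) • Ψ p₀ + s • cr (Ψ p₀) m₀) ∈ frontier K := by
    convert hts using 1; module
  have hin := interior_of_lt_one D.body ht₀ (frontier_subset D.body hx)
    (r := 1 - ε) (by linarith) (by linarith)
  have hout := not_mem_of_one_lt D.body ht₀ hx (r := 1 + ε) (by linarith)
  have hpt' : ∀ r : ℝ, Tendsto (fun n => p n + t₀ • Ψ (p n) +
      r • ((t - t₀) • Ψ (p n) + s • cr (Ψ (p n)) (m n))) atTop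
      (𝓝 (p₀ + t₀ • Ψ p₀ + r • ((t - t₀) • Ψ p₀ + s • cr (Ψ p₀) m₀))) := fun r =>
    (hpt.add (hΨ.const_smul t₀)).add
      (((hΨ.const_smul (t - t₀)).add (hd.const_smul s)).const_smul r)
  have e1 := hφ.tendsto_atTop.eventually
    ((hpt' (1 - ε)).eventually (isOpen_interior.mem_nhds hin))
  have e2 := hφ.tendsto_atTop.eventually
    ((hpt' (1 + ε)).eventually (D.body.1.isClosed.isOpen_compl.mem_nhds hout))
  have e3 := hlim.eventually (Metric.ball_mem_nhds c₀ hδ)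
  obtain ⟨n, h1, h2, h3⟩ := (e1.and (e2.and e3)).exists
  obtain ⟨r, ⟨hr1, hr2⟩, hr⟩ := exists_frontier_segment (by linarith) (interior_subset h1) h2
  refine hball (y := (‖c (φ n)‖⁻¹ • c (φ n), r)) ?_ ?_
  · rw [Prod.dist_eq]
    refine max_lt h3 ?_
    rw [Real.dist_eq, abs_lt]
    constructor <;> linarith
  · simp only [quad_smul]
    rw [hc, mul_zero]
    convert hr using 1; module

/-! ### A quadric through a boundary patch -/

/-- Cramer's rule in the dual basis. -/
theorem dual_cramer (a b c v : E3) :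
    ⟪a, cr b c⟫ • v = ⟪a, v⟫ • cr b c + ⟪b, v⟫ • cr c a + ⟪c, v⟫ • cr a b := by
  apply ext_E3 <;> simp [inner_E3] <;> ring

theorem cr_of_orth {a b u : E3} (hu : ‖u‖ = 1) (ha : ⟪a, u⟫ = 0) (hb : ⟪b, u⟫ = 0) :
    cr a b = ⟪u, cr a b⟫ • u := by
  have h1 : cr u (cr a b) = 0 := by
    rw [cr_cr, real_inner_comm, hb, real_inner_comm, ha]; simp
  have h2 := cr_cr u u (cr a b)
  have h3 : cr u (0 : E3) = 0 := by apply ext_E3 <;> simp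
  rw [h1, h3, inner_self_one hu, one_smul] at h2
  exact (sub_eq_zero.1 h2.symm).symm

theorem inner_cr_ne_zero {a b u : E3} (hu : ‖u‖ = 1) (ha : ⟪a, u⟫ = 0) (hb : ⟪b, u⟫ = 0)
    (hab : cr a b ≠ 0) : ⟪u, cr a b⟫ ≠ 0 := by
  intro h
  rw [cr_of_orth hu ha hb, h, zero_smul] at hab
  exact hab rfl

theorem parallel_of_orth {a b u v : E3} (hu : ‖u‖ = 1) (ha : ⟪a, u⟫ = 0) (hb : ⟪b, u⟫ = 0)
    (hab : cr a b ≠ 0) (hav : ⟪a, v⟫ = 0) (hbv : ⟪b, v⟫ = 0) : v = ⟪u, v⟫ • u := by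
  have h := dual_cramer u a b v
  have h0 := inner_cr_ne_zero hu ha hb hab
  rw [hav, hbv, zero_smul, zero_smul, add_zero, add_zero, cr_of_orth hu ha hb, inner_smul_right,
    inner_self_one hu, mul_one, smul_comm] at h
  exact smul_right_injective _ h0 h

theorem cr_ne_zero_of_abs_lt {a b : E3} (ha : ‖a‖ = 1) (hb : ‖b‖ = 1) (h : |⟪a, b⟫| < 1) :
    cr a b ≠ 0 := by
  intro h0
  rcases eq_or_neg_of_cr ha hb h0 with rfl | rfl
  · rw [inner_self_one hb] at h; simp at h
  · rw [inner_neg_left, inner_self_one hb] at h; simp at h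

theorem injective_five {a b c d e : E3} (h1 : a ≠ b) (h2 : a ≠ c) (h3 : a ≠ d) (h4 : a ≠ e)
    (h5 : b ≠ c) (h6 : b ≠ d) (h7 : b ≠ e) (h8 : c ≠ d) (h9 : c ≠ e) (h10 : d ≠ e) :
    Function.Injective ![a, b, c, d, e] := by
  intro i j hij
  fin_cases i <;> fin_cases j <;> simp_all

/-- Normal form of the conic of a conic normal, centred at an interior point. -/
theorem ConicNormal.recenter {K : Set E3} {Ψ : E3 → E3} {p m : E3} (hK : IsConvexBody K)
    (hu : ‖Ψ p‖ = 1) (hm : ‖m‖ = 1) (hmu : ⟪m, Ψ p⟫ = 0) (h : ConicNormal K Ψ p m) {t₀ : ℝ}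
    (hx : p + t₀ • Ψ p ∈ interior K) :
    ∃ c : Fin 6 → ℝ, c 5 = 1 ∧
      ∀ t s : ℝ, p + t₀ • Ψ p + t • Ψ p + s • cr (Ψ p) m ∈ frontier K → quad c t s = 0 := by
  obtain ⟨c, hc0, hc⟩ := h
  have key : quad c t₀ 0 ≠ 0 := by
    intro h0
    have line : ∀ a b : ℝ, (a, b) ≠ 0 →
        c 0 * a ^ 2 + c 1 * (a * b) + c 2 * b ^ 2 = 0 ∧
        a * (2 * c 0 * t₀ + c 3) + b * (c 1 * t₀ + c 4) = 0 := by
      intro a b hab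
      have hw : a • Ψ p + b • cr (Ψ p) m ≠ 0 := by
        intro hz
        have e1 := congrArg (fun z => ⟪Ψ p, z⟫) hz
        have e2 := congrArg (fun z => ⟪cr (Ψ p) m, z⟫) hz
        simp only [inner_add_right, inner_smul_right, inner_self_one hu, inner_zero_right,
          inner_self_one (norm_cr hu hm hmu), inner_cr_left,
          real_inner_comm (Ψ p) (cr (Ψ p) m)] at e1 e2
        apply hab
        rw [Prod.mk_eq_zero]
        constructor <;> linarith
      obtain ⟨r, s, hr, hs, hr', hs'⟩ := exists_two_frontier hK hx hw
      have e1 : quad c (t₀ + r * a) (r * b) = 0 := hc _ _ (by convert hr' using 1; module)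
      have e2 : quad c (t₀ + s * a) (s * b) = 0 := hc _ _ (by convert hs' using 1; module)
      simp only [quad] at h0 e1 e2
      set Q := c 0 * a ^ 2 + c 1 * (a * b) + c 2 * b ^ 2 with hQ
      set L := a * (2 * c 0 * t₀ + c 3) + b * (c 1 * t₀ + c 4) with hL
      have f1 : r * Q + L = 0 := by
        apply mul_left_cancel₀ hr.ne'
        rw [hQ, hL]; linear_combination e1 - h0
      have f2 : s * Q + L = 0 := by
        apply mul_left_cancel₀ hs.ne
        rw [hQ, hL]; linear_combination e2 - h0
      have hQ0 : Q = 0 := by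
        have : (r - s) * Q = 0 := by linear_combination f1 - f2
        exact (mul_eq_zero.1 this).resolve_left (by linarith)
      exact ⟨hQ0, by rw [hQ0] at f1; linarith⟩
    obtain ⟨a1, a2⟩ := line 1 0 (by simp)
    obtain ⟨b1, b2⟩ := line 0 1 (by simp)
    obtain ⟨d1, d2⟩ := line 1 1 (by simp)
    simp only [quad] at h0
    have c0 : c 0 = 0 := by linarith
    have c2 : c 2 = 0 := by linarith
    have c1 : c 1 = 0 := by linarith
    have c3 : c 3 = 0 := by rw [c0] at a2; linarith
    have c4 : c 4 = 0 := by rw [c1] at b2; linarith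
    have c5 : c 5 = 0 := by rw [c0, c1, c2, c3, c4] at h0; linarith
    apply hc0
    ext i; fin_cases i <;> assumption
  set d := quad c t₀ 0 with hd
  refine ⟨![c 0 / d, c 1 / d, c 2 / d, (2 * c 0 * t₀ + c 3) / d, (c 1 * t₀ + c 4) / d, 1],
    by simp [Matrix.cons_val], fun t s hts => ?_⟩
  have := hc (t₀ + t) s (by convert hts using 1; module)
  simp only [quad, Matrix.cons_val] at this hd ⊢
  field_simp
  rw [hd]
  linear_combination this

/-- The situation around an interior point `x` of the line `L_p` which is crossed by an
elliptic section with normal `n`, together with two conic normals `m, m'` at `p`. -/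
theorem exists_pair_quadric {K : Set E3} {Ψ : E3 → E3} {p m m' n : E3} (hK : IsConvexBody K)
    (hu : ‖Ψ p‖ = 1) (hm : ‖m‖ = 1) (hmu : ⟪m, Ψ p⟫ = 0) (hm' : ‖m'‖ = 1) (hmu' : ⟪m', Ψ p⟫ = 0)
    (hmm : cr m m' ≠ 0) (h : ConicNormal K Ψ p m) (h' : ConicNormal K Ψ p m') {t₀ : ℝ} {x : E3}
    (hxp : x = p + t₀ • Ψ p) (hx : x ∈ interior K) (hn : ⟪n, Ψ p⟫ ≠ 0)
    (hE : IsEllipse (frontier K ∩ {y | ⟪n, y - x⟫ = 0})) :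
    ∃ f : E3 → ℝ, IsQuad f ∧ f x = 1 ∧ ∀ y ∈ frontier K,
      (⟪m, y - x⟫ = 0 → f y = 0) ∧ (⟪m', y - x⟫ = 0 → f y = 0) ∧ (⟪n, y - x⟫ = 0 → f y = 0) := by
  set u := Ψ p with hu_def
  obtain ⟨c, hc5, hc⟩ := h.recenter hK hu hm hmu (t₀ := t₀) (hxp ▸ hx)
  obtain ⟨c', hc5', hc'⟩ := h'.recenter hK hu hm' hmu' (t₀ := t₀) (hxp ▸ hx)
  rw [← hu_def, ← hxp] at hc hc'
  have hu0 : u ≠ 0 := by rintro h0; rw [h0] at hu; simp at hu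
  obtain ⟨r, s, hr, hs, hr', hs'⟩ := exists_two_frontier hK hx hu0
  have e1 := hc r 0 (by simpa using hr')
  have e2 := hc s 0 (by simpa using hs')
  have e1' := hc' r 0 (by simpa using hr')
  have e2' := hc' s 0 (by simpa using hs')
  simp only [quad, hc5, hc5'] at e1 e2 e1' e2'
  have f1 : r * (c 0 - c' 0) + (c 3 - c' 3) = 0 := by
    apply mul_left_cancel₀ hr.ne'; linear_combination e1 - e1'
  have f2 : s * (c 0 - c' 0) + (c 3 - c' 3) = 0 := by
    apply mul_left_cancel₀ hs.ne; linear_combination e2 - e2'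
  have g0 : c 0 = c' 0 := by
    have : (r - s) * (c 0 - c' 0) = 0 := by linear_combination f1 - f2
    have := (mul_eq_zero.1 this).resolve_left (by linarith)
    linarith
  have g3 : c 3 = c' 3 := by rw [g0] at f1; linarith
  have hδ : ⟪m, cr u m'⟫ ≠ 0 := by
    rw [inner_cr_cyclic, cr_anticomm, inner_neg_right]
    exact neg_ne_zero.2 (inner_cr_ne_zero hu hmu hmu' hmm)
  have hδ' : ⟪m', cr u m⟫ = -⟪m, cr u m'⟫ := by
    rw [inner_cr_cyclic, inner_cr_cyclic m, cr_anticomm, inner_neg_right]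
  set δ := ⟪m, cr u m'⟫ with hδdef
  have affin : ∀ (v : E3) (k : ℝ), ∃ (l : E3 →L[ℝ] ℝ) (b : ℝ),
      ∀ y, k * ⟪v, y - x⟫ = l y + b := by
    intro v k
    exact ⟨k • innerSL ℝ v, -(k * ⟪v, x⟫), fun y => by simp [inner_sub_right]; ring⟩
  obtain ⟨lt, bt, hlt⟩ := affin u 1
  obtain ⟨ls, bs, hls⟩ := affin m' (-δ⁻¹)
  obtain ⟨ls', bs', hls'⟩ := affin m δ⁻¹
  have quadl : ∀ l : ℝ, IsQuad (fun y => quad c (1 * ⟪u, y - x⟫) (-δ⁻¹ * ⟪m', y - x⟫)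
      + quad c' (1 * ⟪u, y - x⟫) (δ⁻¹ * ⟪m, y - x⟫)
      - (c 0 * ⟪u, y - x⟫ ^ 2 + c 3 * ⟪u, y - x⟫ + 1)
      + l * ((-δ⁻¹ * ⟪m', y - x⟫) * (δ⁻¹ * ⟪m, y - x⟫))) := by
    intro l
    have := (((isQuad_quad c lt ls bt bs).add (isQuad_quad c' lt ls' bt bs')).add
      ((isQuad_quad ![c 0, 0, 0, c 3, 0, 1] lt lt bt bt).const_mul (-1))).add
      ((isQuad_mul ls ls' bs bs').const_mul l)
    convert this using 2 with y
    rw [← hlt, ← hls, ← hls']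
    simp only [quad, Matrix.cons_val]
    ring
  set g : ℝ → E3 → ℝ := fun l y => quad c (1 * ⟪u, y - x⟫) (-δ⁻¹ * ⟪m', y - x⟫)
      + quad c' (1 * ⟪u, y - x⟫) (δ⁻¹ * ⟪m, y - x⟫)
      - (c 0 * ⟪u, y - x⟫ ^ 2 + c 3 * ⟪u, y - x⟫ + 1)
      + l * ((-δ⁻¹ * ⟪m', y - x⟫) * (δ⁻¹ * ⟪m, y - x⟫)) with hg
  have gm : ∀ l, ∀ y ∈ frontier K, ⟪m, y - x⟫ = 0 → g l y = 0 := by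
    intro l y hy hmy
    have e := plane_coords hu hm hmu hmy
    have hs : -δ⁻¹ * ⟪m', y - x⟫ = ⟪cr u m, y - x⟫ := by
      have e' : y - x = ⟪u, y - x⟫ • u + ⟪cr u m, y - x⟫ • cr u m := by
        nth_rewrite 1 [← e]; module
      have := congrArg (fun z => ⟪m', z⟫) e'
      simp only [inner_add_right, inner_smul_right, hmu', hδ'] at this
      rw [this]; field_simp; ring
    have e2 := hc ⟪u, y - x⟫ ⟪cr u m, y - x⟫ (by rw [e]; exact hy)
    simp only [hg, hs, hmy, mul_zero, one_mul, e2]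
    simp only [quad, hc5', g0, g3]; ring
  have gm' : ∀ l, ∀ y ∈ frontier K, ⟪m', y - x⟫ = 0 → g l y = 0 := by
    intro l y hy hmy
    have e := plane_coords hu hm' hmu' hmy
    have hs : δ⁻¹ * ⟪m, y - x⟫ = ⟪cr u m', y - x⟫ := by
      have e' : y - x = ⟪u, y - x⟫ • u + ⟪cr u m', y - x⟫ • cr u m' := by
        nth_rewrite 1 [← e]; module
      have := congrArg (fun z => ⟪m, z⟫) e'
      simp only [inner_add_right, inner_smul_right, hmu] at this
      rw [this, ← hδdef]; field_simp; ring
    have e2 := hc' ⟪u, y - x⟫ ⟪cr u m', y - x⟫ (by rw [e]; exact hy)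
    simp only [hg, hs, hmy, mul_zero, zero_mul, one_mul, e2]
    simp only [quad, hc5]; ring
  set θ := ⟪m', cr n m⟫ with hθ
  have hθ0 : θ ≠ 0 := by
    rw [hθ, inner_cr_cyclic, cr_of_orth hu hmu hmu', inner_smul_right]
    exact mul_ne_zero (inner_cr_ne_zero hu hmu hmu' hmm) hn
  have hθ' : ⟪m, cr n m'⟫ = -θ := by
    rw [hθ, inner_cr_cyclic, inner_cr_cyclic m', cr_anticomm, inner_neg_right]
  have dne : ∀ d : E3, ⟪m, d⟫ ≠ 0 ∨ ⟪m', d⟫ ≠ 0 → d ≠ 0 := by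
    rintro d h0 rfl
    simp at h0
  obtain ⟨r1, s1, hr1, hs1, ha, hb⟩ := exists_two_frontier hK hx (dne (cr n m) (Or.inr hθ0))
  obtain ⟨r2, s2, hr2, hs2, hc1, hd⟩ := exists_two_frontier hK hx
    (dne (cr n m') (Or.inl (by rw [hθ']; exact neg_ne_zero.2 hθ0)))
  obtain ⟨r3, hr3, he⟩ := exists_ray_frontier hK hx (d := cr n m + cr n m')
    (dne _ (Or.inr (by rw [inner_add_right, inner_cr_right, add_zero]; exact hθ0)))
  set E := x + r3 • (cr n m + cr n m') with hEdef
  have vE : ⟪m, E - x⟫ = -(r3 * θ) ∧ ⟪m', E - x⟫ = r3 * θ := by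
    simp only [hEdef, add_sub_cancel_left, inner_smul_right, inner_add_right, inner_cr_right,
      hθ', ← hθ]
    constructor <;> ring
  have hprod : (-δ⁻¹ * ⟪m', E - x⟫) * (δ⁻¹ * ⟪m, E - x⟫) ≠ 0 := by
    rw [vE.1, vE.2]
    have h1 := mul_ne_zero hr3.ne' hθ0
    have h2 := inv_ne_zero hδ
    exact mul_ne_zero (mul_ne_zero (neg_ne_zero.2 h2) h1) (mul_ne_zero h2 (neg_ne_zero.2 h1))
  set l₀ := -g 0 E / ((-δ⁻¹ * ⟪m', E - x⟫) * (δ⁻¹ * ⟪m, E - x⟫)) with hl₀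
  have gE : g l₀ E = 0 := by
    have : g l₀ E = g 0 E + l₀ * ((-δ⁻¹ * ⟪m', E - x⟫) * (δ⁻¹ * ⟪m, E - x⟫)) := by
      simp only [hg]; ring
    rw [this, hl₀, div_mul_cancel₀ _ hprod]; ring
  refine ⟨g l₀, quadl l₀, by simp [hg, quad, hc5, hc5'], fun y hy =>
    ⟨gm l₀ y hy, gm' l₀ y hy, fun hny => ?_⟩⟩
  have i1 : ∀ t : ℝ, ⟪m, x + t • cr n m - x⟫ = 0 := by
    intro t; rw [add_sub_cancel_left, inner_smul_right, inner_cr_right, mul_zero]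
  have i2 : ∀ t : ℝ, ⟪m', x + t • cr n m' - x⟫ = 0 := by
    intro t; rw [add_sub_cancel_left, inner_smul_right, inner_cr_right, mul_zero]
  have i3 : ∀ t : ℝ, ⟪m', x + t • cr n m - x⟫ = t * θ := by
    intro t; rw [add_sub_cancel_left, inner_smul_right]
  have i4 : ∀ t : ℝ, ⟪m, x + t • cr n m' - x⟫ = -(t * θ) := by
    intro t; rw [add_sub_cancel_left, inner_smul_right, hθ']; ring
  have i5 : ∀ (t : ℝ) (w : E3), ⟪n, x + t • cr n w - x⟫ = 0 := by
    intro t w; rw [add_sub_cancel_left, inner_smul_right, inner_cr_left, mul_zero]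
  have hne : ∀ (v y z : E3), ⟪v, y - x⟫ ≠ ⟪v, z - x⟫ → y ≠ z := by
    rintro v y z h0 rfl; exact h0 rfl
  refine ellipse_five hE (quadl l₀) (y := ![x + r1 • cr n m, x + s1 • cr n m, x + r2 • cr n m',
    x + s2 • cr n m', E]) (injective_five ?_ ?_ ?_ ?_ ?_ ?_ ?_ ?_ ?_ ?_) ?_ ?_ ⟨hy, hny⟩
  · apply hne m'; rw [i3, i3]; intro h0
    have := mul_right_cancel₀ hθ0 h0; linarith
  · apply hne m'; rw [i2, i3]; positivity
  · apply hne m'; rw [i2, i3]; positivity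
  · apply hne m; rw [i1, vE.1]; exact (neg_ne_zero.2 (by positivity)).symm
  · apply hne m'; rw [i2, i3]; exact mul_ne_zero hs1.ne hθ0
  · apply hne m'; rw [i2, i3]; exact mul_ne_zero hs1.ne hθ0
  · apply hne m; rw [i1, vE.1]; exact (neg_ne_zero.2 (by positivity)).symm
  · apply hne m; rw [i4, i4]; intro h0
    have := mul_right_cancel₀ hθ0 (neg_injective h0); linarith
  · apply hne m'; rw [i2, vE.2]; exact Ne.symm (by positivity)
  · apply hne m'; rw [i2, vE.2]; exact Ne.symm (by positivity)
  · intro i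
    fin_cases i
    · exact ⟨ha, i5 _ _⟩
    · exact ⟨hb, i5 _ _⟩
    · exact ⟨hc1, i5 _ _⟩
    · exact ⟨hd, i5 _ _⟩
    · refine ⟨he, ?_⟩
      change ⟪n, E - x⟫ = 0
      simp only [hEdef, add_sub_cancel_left, inner_smul_right, inner_add_right, inner_cr_left]
      ring
  · intro i
    fin_cases i
    · exact gm l₀ _ ha (i1 _)
    · exact gm l₀ _ hb (i1 _)
    · exact gm' l₀ _ hc1 (i2 _)
    · exact gm' l₀ _ hd (i2 _)
    · exact gE

/-- Sections by planes close to a plane through the interior point `x` meet a transversal plane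
through `x` in two boundary points. -/
theorem eventually_two_points {K : Set E3} (hK : IsConvexBody K) {x a k p : E3}
    (hx : x ∈ interior K) {b N : ℕ → E3} (hb : Tendsto b atTop (𝓝 p))
    (hN : Tendsto N atTop (𝓝 a)) (hap : ⟪a, p - x⟫ = 0) (hak : cr a k ≠ 0) :
    ∀ᶠ n in atTop, ∃ y ∈ frontier K, ∃ z ∈ frontier K, y ≠ z ∧ ⟪k, y - x⟫ = 0 ∧ ⟪k, z - x⟫ = 0 ∧
      ⟪N n, y - b n⟫ = 0 ∧ ⟪N n, z - b n⟫ = 0 := by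
  set w := cr k (cr a k) with hw
  have haw : ⟪a, w⟫ ≠ 0 := by
    rw [hw, inner_cr_cyclic, inner_cr_cyclic]
    exact inner_self_ne_zero.2 hak
  have h1 : Tendsto (fun n => ⟪N n, w⟫) atTop (𝓝 ⟪a, w⟫) := hN.inner tendsto_const_nhds
  have h2 : Tendsto (fun n => ⟪N n, b n - x⟫) atTop (𝓝 0) := by
    rw [← hap]; exact hN.inner (hb.sub_const x)
  have h3 : Tendsto (fun n => x + (⟪N n, b n - x⟫ / ⟪N n, w⟫) • w) atTop (𝓝 x) := by
    have := ((h2.div h1 haw).smul_const w).const_add x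
    simpa using this
  have h4 : Tendsto (fun n => cr (N n) k) atTop (𝓝 (cr a k)) := hN.cr tendsto_const_nhds
  filter_upwards [h1.eventually_ne haw, h3.eventually (isOpen_interior.mem_nhds hx),
    h4.eventually_ne hak] with n e1 e2 e3
  obtain ⟨r, s, hr, hs, hr', hs'⟩ := exists_two_frontier hK e2 e3
  have i1 : ∀ t : ℝ, ⟪k, x + (⟪N n, b n - x⟫ / ⟪N n, w⟫) • w + t • cr (N n) k - x⟫ = 0 := by
    intro t
    simp only [inner_sub_right, inner_add_right, inner_smul_right, inner_cr_right, hw,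
      inner_cr_left]
    ring
  have i2 : ∀ t : ℝ, ⟪N n, x + (⟪N n, b n - x⟫ / ⟪N n, w⟫) • w + t • cr (N n) k - b n⟫ = 0 := by
    intro t
    simp only [inner_sub_right, inner_add_right, inner_smul_right, inner_cr_left]
    field_simp
    ring
  refine ⟨_, hr', _, hs', ?_, i1 _, i1 _, i2 _, i2 _⟩
  intro h
  have h' := smul_left_injective ℝ e3 (add_left_cancel h)
  linarith

/-- Near `p`, the quadric through the two conic sections contains the boundary points having a
suitable elliptic normal. -/
theorem eventually_quadric_eq_zero {K : Set E3} (hK : IsConvexBody K) {p x u a m m' k : E3}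
    {b N : ℕ → E3} {f : E3 → ℝ} (hu : ‖u‖ = 1) (hmu : ⟪m, u⟫ = 0) (hmu' : ⟪m', u⟫ = 0)
    (hmm : cr m m' ≠ 0) (hx : x ∈ interior K) {t₀ : ℝ} (hxp : x = p + t₀ • u) (hk : ⟪k, u⟫ ≠ 0)
    (hf : IsQuad f)
    (hf0 : ∀ y ∈ frontier K,
      (⟪m, y - x⟫ = 0 → f y = 0) ∧ (⟪m', y - x⟫ = 0 → f y = 0) ∧ (⟪k, y - x⟫ = 0 → f y = 0))
    (hb : Tendsto b atTop (𝓝 p)) (hN : Tendsto N atTop (𝓝 a)) (hbK : ∀ n, b n ∈ frontier K)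
    (ha : a ≠ 0) (hau : ⟪a, u⟫ = 0) (ham : cr a m ≠ 0) (ham' : cr a m' ≠ 0)
    (hE : ∀ n, IsEllipse (frontier K ∩ {y | ⟪N n, y - b n⟫ = 0}))
    (hL : ∀ n, ¬ (⟪N n, u⟫ = 0 ∧ ⟪N n, x - b n⟫ = 0)) :
    ∀ᶠ n in atTop, f (b n) = 0 := by
  have hap : ⟪a, p - x⟫ = 0 := by
    rw [hxp]; simp [inner_smul_right, hau]
  have hak : cr a k ≠ 0 := by
    intro h0
    have h1 := cr_cr u a k
    have h2 : cr u (0 : E3) = 0 := by apply ext_E3 <;> simp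
    rw [h0, h2, real_inner_comm a u, hau, zero_smul, sub_zero, real_inner_comm k u] at h1
    exact (smul_ne_zero hk ha) h1.symm
  have hxb : Tendsto (fun n => ⟪N n, b n - x⟫) atTop (𝓝 0) := by
    rw [← hap]; exact hN.inner (hb.sub_const x)
  have triple : ∀ m : E3, ⟪m, u⟫ = 0 → cr a m ≠ 0 → ∀ᶠ n in atTop, ∀ y ∈ frontier K,
      ⟪N n, y - b n⟫ = 0 → ⟪k, y - x⟫ = 0 → ⟪m, y - x⟫ ≠ 0 := by
    intro m hmu ham
    have hD : ⟪a, cr k m⟫ ≠ 0 := by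
      rw [inner_cr_cyclic, cr_anticomm, cr_of_orth hu hau hmu, inner_neg_right, inner_smul_right]
      exact neg_ne_zero.2 (mul_ne_zero (inner_cr_ne_zero hu hau hmu ham) hk)
    have h1 : Tendsto (fun n => ⟪N n, cr k m⟫) atTop (𝓝 ⟪a, cr k m⟫) :=
      hN.inner tendsto_const_nhds
    have h3 : Tendsto (fun n => x + (⟪N n, b n - x⟫ / ⟪N n, cr k m⟫) • cr k m) atTop (𝓝 x) := by
      have := ((hxb.div h1 hD).smul_const (cr k m)).const_add x
      simpa using this
    filter_upwards [h1.eventually_ne hD, h3.eventually (isOpen_interior.mem_nhds hx)]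
      with n e1 e2 y hy hNy hky hmy
    have h4 := dual_cramer (N n) k m (y - x)
    have h5 : ⟪N n, y - x⟫ = ⟪N n, b n - x⟫ := by
      simp only [inner_sub_right] at hNy ⊢; linarith
    rw [hky, hmy, zero_smul, zero_smul, add_zero, add_zero, h5] at h4
    have h6 : y = x + (⟪N n, b n - x⟫ / ⟪N n, cr k m⟫) • cr k m := by
      rw [div_eq_inv_mul, mul_smul, ← h4, smul_smul, inv_mul_cancel₀ e1]; simp
    rw [h6] at hy
    exact not_mem_interior_of_frontier hy e2
  filter_upwards [eventually_two_points hK hx hb hN hap ham,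
    eventually_two_points hK hx hb hN hap ham', eventually_two_points hK hx hb hN hap hak,
    triple m hmu ham, triple m' hmu' ham'] with n e1 e2 e3 e4 e5
  obtain ⟨y1, hy1, y2, hy2, hy, a1, a2, a3, a4⟩ := e1
  obtain ⟨z1, hz1, z2, hz2, hz, b1, b2, b3, b4⟩ := e2
  obtain ⟨w1, hw1, w2, hw2, hw, c1, c2, c3, c4⟩ := e3
  have uniq : ∀ y z : E3, ⟪m, y - x⟫ = 0 → ⟪m', y - x⟫ = 0 → ⟪m, z - x⟫ = 0 → ⟪m', z - x⟫ = 0 →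
      ⟪N n, y - b n⟫ = 0 → ⟪N n, z - b n⟫ = 0 → y = z := by
    intro y z h1 h2 h3 h4 h5 h6
    have hy' := parallel_of_orth hu hmu hmu' hmm h1 h2
    have hz' := parallel_of_orth hu hmu hmu' hmm h3 h4
    have hyz : y - z = (⟪u, y - x⟫ - ⟪u, z - x⟫) • u := by
      rw [sub_smul, ← hy', ← hz']; abel
    have h7 : (⟪u, y - x⟫ - ⟪u, z - x⟫) * ⟪N n, u⟫ = 0 := by
      rw [← inner_smul_right, ← hyz]
      simp only [inner_sub_right] at h5 h6 ⊢; linarith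
    rcases mul_eq_zero.1 h7 with h8 | h8
    · rw [h8, zero_smul] at hyz
      exact sub_eq_zero.1 hyz
    · exfalso
      refine hL n ⟨h8, ?_⟩
      have h9 : ⟪N n, y - x⟫ = 0 := by rw [hy', inner_smul_right, h8, mul_zero]
      simp only [inner_sub_right] at h5 h9 ⊢; linarith
  have five : ∀ y : E3, y ∈ frontier K → ⟪m, y - x⟫ = 0 → ⟪N n, y - b n⟫ = 0 → y ≠ z1 → y ≠ z2 →
      f (b n) = 0 := by
    intro y hyK h1 h2 h3 h4
    have hne : ∀ y w : E3, w ∈ frontier K → ⟪N n, w - b n⟫ = 0 → ⟪k, w - x⟫ = 0 →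
        (⟪m, y - x⟫ = 0 ∨ ⟪m', y - x⟫ = 0) → y ≠ w := by
      rintro y w hw i1 i2 (i3 | i3) rfl
      · exact e4 y hw i1 i2 i3
      · exact e5 y hw i1 i2 i3
    refine ellipse_five (hE n) hf (y := ![y, z1, z2, w1, w2])
      (injective_five h3 h4 (hne _ _ hw1 c3 c1 (Or.inl h1)) (hne _ _ hw2 c4 c2 (Or.inl h1)) hz
        (hne _ _ hw1 c3 c1 (Or.inr b1)) (hne _ _ hw2 c4 c2 (Or.inr b1))
        (hne _ _ hw1 c3 c1 (Or.inr b2)) (hne _ _ hw2 c4 c2 (Or.inr b2)) hw) ?_ ?_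
      ⟨hbK n, by simp⟩
    · intro i
      fin_cases i
      · exact ⟨hyK, h2⟩
      · exact ⟨hz1, b3⟩
      · exact ⟨hz2, b4⟩
      · exact ⟨hw1, c3⟩
      · exact ⟨hw2, c4⟩
    · intro i
      fin_cases i
      · exact (hf0 _ hyK).1 h1
      · exact (hf0 _ hz1).2.1 b1
      · exact (hf0 _ hz2).2.1 b2
      · exact (hf0 _ hw1).2.2 c1
      · exact (hf0 _ hw2).2.2 c2
  by_cases h1 : y1 = z1 ∨ y1 = z2
  · have hm1 : ⟪m', y1 - x⟫ = 0 := by rcases h1 with rfl | rfl <;> assumption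
    have h2 : ⟪m', y2 - x⟫ ≠ 0 := fun h2 => hy (uniq y1 y2 a1 hm1 a2 h2 a3 a4)
    refine five y2 hy2 a2 a4 ?_ ?_
    · rintro rfl; exact h2 b1
    · rintro rfl; exact h2 b2
  · push Not at h1
    exact five y1 hy1 a1 a3 h1.1 h1.2

/-- If there are three pairwise independent conic normals at `p`, then a piece of the boundary
lies on a quadric. -/
theorem exists_patch {K : Set E3} {Ψ : E3 → E3} {κ : ℝ} (D : OutwardData K Ψ κ) {p : E3}
    (hp : p ∈ frontier K) {m : Fin 3 → E3} (hm : ∀ i, ‖m i‖ = 1) (hmu : ∀ i, ⟪m i, Ψ p⟫ = 0)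
    (hmm : ∀ i j, i ≠ j → cr (m i) (m j) ≠ 0) (hC : ∀ i, ConicNormal K Ψ p (m i)) :
    ∃ f : E3 → ℝ, IsQuad f ∧ ∃ x ∈ interior K, f x = 1 ∧
      ∃ U : Set E3, IsOpen U ∧ (U ∩ frontier K).Nonempty ∧ ∀ y ∈ U ∩ frontier K, f y = 0 := by
  have hu := D.norm p hp
  set u := Ψ p with hu_def
  obtain ⟨q, hq, hqL, t₀, s₀, hx, hxq⟩ := D.cross p hp
  set x := p + t₀ • Ψ p with hxdef
  have hcr : ∀ {b ν₁ ν₂ : E3}, EllipticNormal K Ψ b ν₁ → EllipticNormal K Ψ b ν₂ →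
      |⟪ν₁, ν₂⟫| ≤ κ → cr ν₁ ν₂ ≠ 0 := fun h1 h2 h3 =>
    cr_ne_zero_of_abs_lt h1.norm h2.norm (h3.trans_lt D.kappa)
  obtain ⟨k, hk, hkE⟩ : ∃ k : E3, ⟪k, u⟫ ≠ 0 ∧ IsEllipse (frontier K ∩ {y | ⟪k, y - x⟫ = 0}) := by
    obtain ⟨ν₁, ν₂, h1, h2, h3⟩ := D.planes q hq
    have conv : ∀ ν, EllipticNormal K Ψ q ν → IsEllipse (frontier K ∩ {y | ⟪ν, y - x⟫ = 0}) := by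
      intro ν h
      convert h.ellipse using 3 with y
      ext y
      simp [hxq, inner_sub_right, inner_add_right, inner_smul_right, h.orth]
    by_contra hcon
    push Not at hcon
    have k1 : ⟪ν₁, u⟫ = 0 := by by_contra h; exact hcon _ h (conv _ h1)
    have k2 : ⟪ν₂, u⟫ = 0 := by by_contra h; exact hcon _ h (conv _ h2)
    have hpar := parallel_of_orth (D.norm q hq) h1.orth h2.orth (hcr h1 h2 h3) k1 k2
    set c := ⟪Ψ q, u⟫
    have hc : c ≠ 0 := by
      intro hc
      rw [hc, zero_smul] at hpar
      rw [hpar] at hu; simp at hu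
    refine hqL ⟨t₀ - s₀ * c⁻¹, ?_⟩
    have e1 : Ψ q = c⁻¹ • u := by rw [hpar, smul_smul, inv_mul_cancel₀ hc, one_smul]
    have e2 : q = x - s₀ • Ψ q := by rw [hxq]; simp
    rw [e2, e1, hxdef, ← hu_def]
    module
  have hpair : ∀ i j, i ≠ j → ∃ f : E3 → ℝ, IsQuad f ∧ f x = 1 ∧ ∀ y ∈ frontier K,
      (⟪m i, y - x⟫ = 0 → f y = 0) ∧ (⟪m j, y - x⟫ = 0 → f y = 0) ∧ (⟪k, y - x⟫ = 0 → f y = 0) :=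
    fun i j hij => exists_pair_quadric D.body hu (hm i) (hmu i) (hm j) (hmu j) (hmm i j hij)
      (hC i) (hC j) hxdef hx hk hkE
  obtain ⟨f₁, q1, x1, z1⟩ := hpair 0 1 (by decide)
  obtain ⟨f₂, q2, x2, z2⟩ := hpair 0 2 (by decide)
  obtain ⟨f₃, q3, x3, z3⟩ := hpair 1 2 (by decide)
  have hev : ∀ᶠ b in 𝓝[frontier K] p, f₁ b = 0 ∨ f₂ b = 0 ∨ f₃ b = 0 := by
    by_contra hcon
    obtain ⟨b, hbt, hb⟩ := exists_seq_forall_of_frequently (not_eventually.1 hcon)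
    rw [tendsto_nhdsWithin_iff] at hbt
    obtain ⟨hbt, hbK'⟩ := hbt
    obtain ⟨n₀, hn₀⟩ := eventually_atTop.1 hbK'
    set b' := fun n => b (n + n₀) with hb'
    have hbK : ∀ n, b' n ∈ frontier K := fun n => hn₀ _ (by omega)
    have hbt' : Tendsto b' atTop (𝓝 p) := (tendsto_add_atTop_iff_nat n₀).2 hbt
    have hb0 : ∀ n, f₁ (b' n) ≠ 0 ∧ f₂ (b' n) ≠ 0 ∧ f₃ (b' n) ≠ 0 := by
      intro n
      have := hb (n + n₀)
      push Not at this
      exact this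
    have hsel : ∀ n, ∃ ν, EllipticNormal K Ψ (b' n) ν ∧
        ¬ (⟪ν, u⟫ = 0 ∧ ⟪ν, x - b' n⟫ = 0) := by
      intro n
      obtain ⟨ν₁, ν₂, h1, h2, h3⟩ := D.planes (b' n) (hbK n)
      by_contra hcon
      push Not at hcon
      obtain ⟨k1, l1⟩ := hcon _ h1
      obtain ⟨k2, l2⟩ := hcon _ h2
      have hpar := parallel_of_orth hu k1 k2 (hcr h1 h2 h3) l1 l2
      apply (hb0 n).1
      apply (z1 _ (hbK n)).1
      rw [← neg_sub, hpar, inner_neg_right, inner_smul_right, hmu, mul_zero, neg_zero]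
    choose N hNE hNL using hsel
    obtain ⟨a, ha, φ, hφ, hlim⟩ := (isCompact_sphere (0 : E3) 1).tendsto_subseq
      (x := N) (fun n => by simpa using (hNE n).norm)
    have ha1 : ‖a‖ = 1 := by simpa using ha
    have ha0 : a ≠ 0 := by rintro rfl; simp at ha1
    have hbφ := hbt'.comp hφ.tendsto_atTop
    have hau : ⟪a, u⟫ = 0 := by
      have hΨ : Tendsto (fun n => Ψ (b' (φ n))) atTop (𝓝 u) :=
        (D.cont p hp).tendsto.comp
          (tendsto_nhdsWithin_iff.2 ⟨hbφ, Eventually.of_forall fun n => hbK _⟩)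
      refine tendsto_nhds_unique (hlim.inner hΨ) ?_
      simp only [Function.comp_apply, (hNE _).orth]
      exact tendsto_const_nhds
    have main : ∀ i j, i ≠ j → cr a (m i) ≠ 0 → cr a (m j) ≠ 0 → ∀ f : E3 → ℝ, IsQuad f →
        (∀ y ∈ frontier K, (⟪m i, y - x⟫ = 0 → f y = 0) ∧ (⟪m j, y - x⟫ = 0 → f y = 0) ∧
          (⟪k, y - x⟫ = 0 → f y = 0)) → (∀ n, f (b' n) ≠ 0) → False := by
      intro i j hij hi hj f hf hf0 hfb
      obtain ⟨n, hn⟩ := (eventually_quadric_eq_zero D.body hu (hmu i) (hmu j) (hmm i j hij) hx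
        hxdef hk hf hf0 hbφ hlim (fun n => hbK _) ha0 hau hi hj (fun n => (hNE _).ellipse)
        (fun n => hNL _)).exists
      exact hfb _ hn
    have hpar : ∀ i j, i ≠ j → cr a (m i) = 0 → cr a (m j) ≠ 0 := by
      intro i j hij hi hj
      apply hmm i j hij
      rcases eq_or_neg_of_cr ha1 (hm i) hi with h | h
      · rw [← h, hj]
      · have : m i = -a := by rw [h, neg_neg]
        rw [this]
        apply ext_E3 <;> [have := congrArg (fun z : E3 => z 0) hj;
          have := congrArg (fun z : E3 => z 1) hj; have := congrArg (fun z : E3 => z 2) hj] <;>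
        simp at this ⊢ <;> linarith
    by_cases h0 : cr a (m 0) = 0
    · exact main 1 2 (by decide) (hpar 0 1 (by decide) h0) (hpar 0 2 (by decide) h0) f₃ q3 z3
        fun n => (hb0 n).2.2
    · by_cases h1 : cr a (m 1) = 0
      · exact main 0 2 (by decide) h0 (hpar 1 2 (by decide) h1) f₂ q2 z2 fun n => (hb0 n).2.1
      · exact main 0 1 (by decide) h0 h1 f₁ q1 z1 fun n => (hb0 n).1
  obtain ⟨V, hVo, hpV, hV⟩ := mem_nhdsWithin.1 hev
  by_cases h1 : ∀ y ∈ V ∩ frontier K, f₁ y = 0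
  · exact ⟨f₁, q1, x, hx, x1, V, hVo, ⟨p, hpV, hp⟩, h1⟩
  push Not at h1
  obtain ⟨y1, hy1, hy1'⟩ := h1
  have o1 : IsOpen (V ∩ {y | f₁ y ≠ 0}) := hVo.inter (isOpen_ne_fun q1.continuous continuous_const)
  by_cases h2 : ∀ y ∈ (V ∩ {y | f₁ y ≠ 0}) ∩ frontier K, f₂ y = 0
  · exact ⟨f₂, q2, x, hx, x2, _, o1, ⟨y1, ⟨hy1.1, hy1'⟩, hy1.2⟩, h2⟩
  push Not at h2
  obtain ⟨y2, hy2, hy2'⟩ := h2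
  refine ⟨f₃, q3, x, hx, x3, _, o1.inter (isOpen_ne_fun q2.continuous continuous_const),
    ⟨y2, ⟨hy2.1, hy2'⟩, hy2.2⟩, ?_⟩
  rintro y ⟨⟨⟨hyV, hy1⟩, hy2⟩, hyK⟩
  rcases hV ⟨hyV, hyK⟩ with h | h | h
  · exact absurd h hy1
  · exact absurd h hy2
  · exact h

/-! ### Quadrics containing the boundary -/

/-- A positive definite form on `E3` is the square of a Euclidean norm. -/
theorem exists_linearEquiv_norm_sq (B : E3 →L[ℝ] E3 →L[ℝ] ℝ) (hB : ∀ w, w ≠ 0 → 0 < B w w) :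
    ∃ T : E3 ≃ₗ[ℝ] E3, ∀ w, B w w = ‖T w‖ ^ 2 := by
  set Q : QuadraticForm ℝ E3 := LinearMap.BilinMap.toQuadraticMap
    (LinearMap.mk₂ ℝ (fun v w => B v w) (by simp) (by simp) (by simp) (by simp)) with hQ
  have hQB : ∀ w, Q w = B w w := fun w => by simp [hQ]
  obtain ⟨c, hc, ⟨e⟩⟩ := Q.equivalent_one_zero_neg_one_weighted_sum_squared
  have hc1 : ∀ i, c i = 1 := by
    intro i
    have h1 : e.symm (Pi.single i 1) ≠ 0 := by
      intro h0
      have h2 : e.symm (Pi.single i 1) = e.symm 0 := by rw [h0]; simp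
      have := e.symm.toLinearEquiv.injective h2
      simp at this
    have h2 := hB _ h1
    rw [← hQB, e.symm.map_app, QuadraticMap.weightedSumSquares_apply] at h2
    simp [Pi.single_apply] at h2
    rcases hc i with h | h | h <;> simp_all <;> linarith
  have hd : Module.finrank ℝ E3 = 3 := by simp
  set T₀ : E3 →ₗ[ℝ] E3 :=
    { toFun := fun w => WithLp.toLp 2 fun i => e w (Fin.cast hd.symm i)
      map_add' := fun v w => by ext i; simp
      map_smul' := fun a w => by ext i; simp } with hT₀
  have hT : ∀ w, B w w = ‖T₀ w‖ ^ 2 := by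
    intro w
    rw [← hQB, ← e.map_app, QuadraticMap.weightedSumSquares_apply, EuclideanSpace.norm_sq_eq,
      ← (finCongr hd.symm).sum_comp]
    simp [hc1, hT₀, sq]
  have hinj : Function.Injective T₀ := by
    rw [injective_iff_map_eq_zero]
    intro w hw
    by_contra h0
    have := hB w h0
    rw [hT, hw] at this
    simp at this
  exact ⟨LinearEquiv.ofInjectiveEndo T₀ hinj, fun w => by simpa using hT w⟩

/-- A convex body whose boundary lies on a quadric not containing some interior point is bounded
by an ellipsoid. -/
theorem isEllipsoid_of_quadric {K : Set E3} (hK : IsConvexBody K) {f : E3 → ℝ} (hf : IsQuad f)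
    {x : E3} (hx : x ∈ interior K) (hfx : f x = 1) (h0 : ∀ y ∈ frontier K, f y = 0) :
    IsEllipsoid (frontier K) := by
  obtain ⟨B, l, hBl⟩ := hf.line x
  rw [hfx] at hBl
  have two : ∀ w : E3, w ≠ 0 → ∃ r s : ℝ, 0 < r ∧ s < 0 ∧ x + r • w ∈ frontier K ∧
      x + s • w ∈ frontier K ∧ B w w * r ^ 2 + l w * r + 1 = 0 ∧
      B w w * s ^ 2 + l w * s + 1 = 0 := by
    intro w hw
    obtain ⟨r, s, hr, hs, hr', hs'⟩ := exists_two_frontier hK hx hw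
    have e1 := h0 _ hr'
    have e2 := h0 _ hs'
    rw [hBl] at e1 e2
    simp only [map_smul, smul_apply, smul_eq_mul] at e1 e2
    exact ⟨r, s, hr, hs, hr', hs', by linear_combination e1, by linear_combination e2⟩
  have vieta : ∀ w : E3, ∀ r s : ℝ, 0 < r → s < 0 → B w w * r ^ 2 + l w * r + 1 = 0 →
      B w w * s ^ 2 + l w * s + 1 = 0 → B w w * (r * s) = 1 := by
    intro w r s hr hs e1 e2
    have : (r - s) * (B w w * (r * s) - 1) = 0 := by linear_combination s * e1 - r * e2
    linarith [(mul_eq_zero.1 this).resolve_left (by linarith)]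
  have neg : ∀ w : E3, w ≠ 0 → 0 < (-B) w w := by
    intro w hw
    obtain ⟨r, s, hr, hs, -, -, e1, e2⟩ := two w hw
    have h1 := vieta w r s hr hs e1 e2
    have h2 : r * s < 0 := mul_neg_of_pos_of_neg hr hs
    simp only [neg_apply]
    by_contra h3
    nlinarith
  have hfr : ∀ y, y ∈ frontier K ↔ f y = 0 := by
    refine fun y => ⟨h0 y, fun hy => ?_⟩
    set w := y - x with hw
    have hyw : y = x + w := by rw [hw]; abel
    have hw0 : w ≠ 0 := by
      intro h
      rw [hyw, h, add_zero, hfx] at hy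
      norm_num at hy
    obtain ⟨r, s, hr, hs, hr', hs', e1, e2⟩ := two w hw0
    have h1 := vieta w r s hr hs e1 e2
    rw [hyw, hBl] at hy
    have hfac : (1 - r) * (1 - s) = 0 := by
      have h2 := neg w hw0
      simp only [neg_apply] at h2
      apply mul_left_cancel₀ (show B w w ≠ 0 by linarith)
      have h3 : l w = -(B w w * (r + s)) := by
        have : (r - s) * (l w + B w w * (r + s)) = 0 := by linear_combination e1 - e2
        linarith [(mul_eq_zero.1 this).resolve_left (by linarith)]
      linear_combination hy - h3 + h1
    rcases mul_eq_zero.1 hfac with h | h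
    · rw [show r = 1 by linarith, one_smul, ← hyw] at hr'; exact hr'
    · rw [show s = 1 by linarith, one_smul, ← hyw] at hs'; exact hs'
  obtain ⟨T, hT⟩ := exists_linearEquiv_norm_sq (-B) neg
  set k : E3 := (1 / 2 : ℝ) • (InnerProductSpace.toDual ℝ E3).symm
    (l.comp T.symm.toLinearMap.toContinuousLinearMap) with hk
  have hkl : ∀ w, 2 * ⟪k, T w⟫ = l w := by
    intro w
    rw [hk, inner_smul_left, InnerProductSpace.toDual_symm_apply]
    simp
  set ρ := Real.sqrt (1 + ‖k‖ ^ 2) with hρ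
  have hρ0 : 0 < ρ := Real.sqrt_pos.2 (by positivity)
  have hρ2 : ρ ^ 2 = 1 + ‖k‖ ^ 2 := Real.sq_sqrt (by positivity)
  have heq : ∀ y, f y = ρ ^ 2 - ‖T (y - x) - k‖ ^ 2 := by
    intro y
    have e1 : y = x + (y - x) := by abel
    have e2 := hT (y - x)
    simp only [neg_apply] at e2
    nth_rewrite 1 [e1]
    rw [hBl, norm_sub_sq_real, ← e2, hρ2, ← hkl, real_inner_comm]
    ring
  refine ⟨(((LinearEquiv.smulOfNeZero ℝ E3 ρ hρ0.ne').trans T.symm).toAffineEquiv).trans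
    (AffineEquiv.constVAdd ℝ E3 (x + T.symm k)), ?_⟩
  have hF : ∀ z, ((((LinearEquiv.smulOfNeZero ℝ E3 ρ hρ0.ne').trans T.symm).toAffineEquiv).trans
    (AffineEquiv.constVAdd ℝ E3 (x + T.symm k))) z = x + T.symm k + T.symm (ρ • z) := fun z => rfl
  ext y
  rw [hfr, heq]
  simp only [Set.mem_image, mem_sphere_zero_iff_norm]
  constructor
  · intro hy
    refine ⟨ρ⁻¹ • (T (y - x) - k), ?_, ?_⟩
    · have : ‖T (y - x) - k‖ = ρ := by
        rw [← abs_of_pos hρ0, ← abs_of_nonneg (norm_nonneg (T (y - x) - k)),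
          ← sq_eq_sq_iff_abs_eq_abs]
        linarith
      rw [norm_smul, norm_inv, this, Real.norm_of_nonneg hρ0.le, inv_mul_cancel₀ hρ0.ne']
    · rw [hF, smul_smul, mul_inv_cancel₀ hρ0.ne', one_smul, map_sub, T.symm_apply_apply]
      abel
  · rintro ⟨z, hz, rfl⟩
    rw [hF]
    have : T (x + T.symm k + T.symm (ρ • z) - x) - k = ρ • z := by
      rw [show x + T.symm k + T.symm (ρ • z) - x = T.symm k + T.symm (ρ • z) by abel, map_add,
        T.apply_symm_apply, T.apply_symm_apply]
      abel
    rw [this, norm_smul, hz, mul_one, Real.norm_of_nonneg hρ0.le, sub_self]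

/-! ### Propagation of a quadric patch -/

theorem eq_zero_of_inner {a b c v : E3} (h : ⟪a, cr b c⟫ ≠ 0) (ha : ⟪a, v⟫ = 0) (hb : ⟪b, v⟫ = 0)
    (hc : ⟪c, v⟫ = 0) : v = 0 := by
  have := dual_cramer a b c v
  rw [ha, hb, hc, zero_smul, zero_smul, zero_smul, add_zero, add_zero] at this
  exact (smul_eq_zero.1 this).resolve_left h

theorem frame_det_ne_zero {u m m' : E3} (hu : ‖u‖ = 1) (hm : ⟪m, u⟫ = 0) (hm' : ⟪m', u⟫ = 0)
    (h : cr m m' ≠ 0) : ⟪u, cr (cr u m) (cr u m')⟫ ≠ 0 := by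
  have h1 : ⟪u, cr (cr u m) (cr u m')⟫ = ⟪u, cr m m'⟫ := by
    rw [cr_cr, inner_sub_right, inner_smul_right, inner_smul_right, inner_self_one hu,
      real_inner_comm m' u, hm', real_inner_comm m', ← inner_cr_cyclic]
    ring_nf
    rw [inner_cr_cyclic, inner_cr_cyclic]
  rw [h1]
  exact inner_cr_ne_zero hu hm hm' h

/-- A support functional at a point of an ellipse in the boundary vanishes on the tangent. -/
theorem exists_tangent {K : Set E3} {p n u ν₀ : E3} (hu : ‖u‖ = 1) (hn : ‖n‖ = 1)
    (hnu : ⟪n, u⟫ = 0) (hE : IsEllipse (frontier K ∩ {y | ⟪n, y - p⟫ = 0})) (hp : p ∈ frontier K)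
    (hν₀ : 0 < ⟪ν₀, u⟫) (hsup₀ : ∀ y ∈ frontier K, ⟪ν₀, y - p⟫ ≤ 0) :
    ∃ μ : ℝ, ∀ ν : E3, (∀ y ∈ frontier K, ⟪ν, y - p⟫ ≤ 0) → ⟪ν, cr u n⟫ = μ * ⟪ν, u⟫ := by
  obtain ⟨o, a, b, h1, h2, h3, -⟩ := hE.exists_param
  obtain ⟨c, s, hcs, hpo⟩ := h2 p ⟨hp, by simp⟩
  set τ := (-s) • a + c • b with hτ
  have hrot : ∀ θ : ℝ, p + (Real.cos θ - 1) • (c • a + s • b) + Real.sin θ • τ ∈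
      frontier K ∩ {y | ⟪n, y - p⟫ = 0} := by
    intro θ
    have := h1 (c * Real.cos θ - s * Real.sin θ) (s * Real.cos θ + c * Real.sin θ) (by
      have := Real.sin_sq_add_cos_sq θ
      linear_combination (c ^ 2 + s ^ 2) * this + hcs)
    convert this using 1
    nth_rewrite 1 [hpo]
    rw [hτ]; module
  have tang : ∀ ν : E3, (∀ y ∈ frontier K, ⟪ν, y - p⟫ ≤ 0) → ⟪ν, τ⟫ = 0 := by
    intro ν hν
    have hd : HasDerivAt (fun θ : ℝ => (Real.cos θ - 1) * ⟪ν, c • a + s • b⟫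
        + Real.sin θ * ⟪ν, τ⟫) (-Real.sin 0 * ⟪ν, c • a + s • b⟫ + Real.cos 0 * ⟪ν, τ⟫) 0 :=
      (((Real.hasDerivAt_cos 0).sub_const 1).mul_const _).add
        ((Real.hasDerivAt_sin 0).mul_const _)
    have hmax : IsLocalMax (fun θ : ℝ => (Real.cos θ - 1) * ⟪ν, c • a + s • b⟫
        + Real.sin θ * ⟪ν, τ⟫) 0 := by
      refine Eventually.of_forall fun θ => ?_
      have := hν _ (hrot θ).1
      simp only [add_assoc, add_sub_cancel_left] at this
      rw [inner_add_right, inner_smul_right, inner_smul_right] at this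
      simpa using this
    have := hmax.hasDerivAt_eq_zero hd
    simpa using this
  have hτ0 : τ ≠ 0 := by
    intro h
    obtain ⟨e1, e2⟩ := h3 _ _ h
    rw [neg_eq_zero] at e1
    rw [e1, e2] at hcs; norm_num at hcs
  have hnτ : ⟪n, τ⟫ = 0 := by
    have e1 := (hrot (Real.pi / 2)).2
    have e2 := (hrot (-(Real.pi / 2))).2
    simp only [Set.mem_ofPred_eq, add_assoc, add_sub_cancel_left, inner_add_right,
      inner_smul_right, Real.cos_neg, Real.sin_neg, Real.sin_pi_div_two] at e1 e2 ⊢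
    linarith
  have hexp := frame_expand hu hn hnu τ
  rw [real_inner_comm n τ, hnτ, zero_smul, add_zero] at hexp
  set A := ⟪τ, u⟫
  set B := ⟪τ, cr u n⟫
  have key : ∀ ν : E3, (∀ y ∈ frontier K, ⟪ν, y - p⟫ ≤ 0) → A * ⟪ν, u⟫ + B * ⟪ν, cr u n⟫ = 0 := by
    intro ν hν
    have := tang ν hν
    rwa [hexp, inner_add_right, inner_smul_right, inner_smul_right] at this
  have hB : B ≠ 0 := by
    intro hB
    have h4 := key ν₀ hsup₀
    rw [hB, zero_mul, add_zero] at h4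
    have hA : A = 0 := (mul_eq_zero.1 h4).resolve_right hν₀.ne'
    rw [hA, hB] at hexp
    exact hτ0 (by simpa using hexp)
  refine ⟨-A / B, fun ν hν => ?_⟩
  have := key ν hν
  field_simp
  linarith

/-- `K` is smooth at every boundary point: a support functional determines the tangent cone. -/
theorem exists_smooth_support {K : Set E3} {Ψ : E3 → E3} {κ : ℝ} (D : OutwardData K Ψ κ) {p : E3}
    (hp : p ∈ frontier K) : ∃ ν : E3, (∀ y ∈ K, ⟪ν, y - p⟫ ≤ 0) ∧
      (∀ y ∈ interior K, ⟪ν, y - p⟫ < 0) ∧ 0 < ⟪ν, Ψ p⟫ ∧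
      ∀ w, ⟪ν, w⟫ < 0 → ∃ t : ℝ, 0 < t ∧ p + t • w ∈ interior K := by
  have hcl : K ⊆ closure (interior K) := by
    rw [D.body.2.1.closure_interior_eq_closure_of_nonempty_interior D.body.2.2]
    exact subset_closure
  have le_of_lt : ∀ ν : E3, (∀ y ∈ interior K, ⟪ν, y - p⟫ < 0) → ∀ y ∈ K, ⟪ν, y - p⟫ ≤ 0 := by
    intro ν hν y hy
    have hc : IsClosed {y : E3 | ⟪ν, y - p⟫ ≤ 0} := isClosed_le (by fun_prop) continuous_const
    exact hc.closure_subset_iff.2 (fun z hz => (hν z hz).le) (hcl hy)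
  obtain ⟨t₀, ht₀, hx⟩ := D.inner_mem p hp
  have pos : ∀ ν : E3, (∀ y ∈ interior K, ⟪ν, y - p⟫ < 0) → 0 < ⟪ν, Ψ p⟫ := by
    intro ν hν
    have := hν _ hx
    rw [add_sub_cancel_left, inner_smul_right] at this
    nlinarith
  obtain ⟨f, hf⟩ := geometric_hahn_banach_open_point D.body.2.1.interior isOpen_interior
    (not_mem_interior_of_frontier hp)
  set ν := (InnerProductSpace.toDual ℝ E3).symm f with hνdef
  have hνf : ∀ y, ⟪ν, y⟫ = f y := fun y => InnerProductSpace.toDual_symm_apply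
  have hν : ∀ y ∈ interior K, ⟪ν, y - p⟫ < 0 := by
    intro y hy
    rw [hνf, map_sub]; linarith [hf y hy]
  have hνK := le_of_lt ν hν
  refine ⟨ν, hνK, hν, pos ν hν, fun w hw => ?_⟩
  by_contra hcon
  push Not at hcon
  have hconv : Convex ℝ ((fun t : ℝ => p + t • w) '' Set.Ioi 0) := by
    have : Convex ℝ (AffineMap.lineMap p (p + w) '' Set.Ioi (0 : ℝ)) :=
      (convex_Ioi 0).affine_image (AffineMap.lineMap p (p + w))
    convert this using 2 with t
    ext t
    simp [AffineMap.lineMap_apply, add_comm]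
  have hdis : Disjoint (interior K) ((fun t : ℝ => p + t • w) '' Set.Ioi 0) := by
    rw [Set.disjoint_right]
    rintro _ ⟨t, ht, rfl⟩
    exact hcon t ht
  obtain ⟨g, a, hg1, hg2⟩ := geometric_hahn_banach_open D.body.2.1.interior isOpen_interior
    hconv hdis
  have hga : g p = a := by
    apply le_antisymm
    · have hc : IsClosed {y : E3 | g y ≤ a} := isClosed_le (by fun_prop) continuous_const
      exact hc.closure_subset_iff.2 (fun z hz => (hg1 z hz).le) (hcl (frontier_subset D.body hp))
    · have : Tendsto (fun t : ℝ => g (p + t • w)) (𝓝[>] 0) (𝓝 (g (p + (0 : ℝ) • w))) :=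
        ((by fun_prop : Continuous fun t : ℝ => g (p + t • w)).tendsto 0).mono_left
          nhdsWithin_le_nhds
      rw [zero_smul, add_zero] at this
      refine ge_of_tendsto this ?_
      filter_upwards [self_mem_nhdsWithin] with t ht
      exact hg2 _ ⟨t, ht, rfl⟩
  set ν' := (InnerProductSpace.toDual ℝ E3).symm g with hν'def
  have hνg : ∀ y, ⟪ν', y⟫ = g y := fun y => InnerProductSpace.toDual_symm_apply
  have hν' : ∀ y ∈ interior K, ⟪ν', y - p⟫ < 0 := by
    intro y hy
    rw [hνg, map_sub, hga]; linarith [hg1 y hy]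
  have hw' : 0 ≤ ⟪ν', w⟫ := by
    have := hg2 _ ⟨1, Set.mem_Ioi.2 one_pos, rfl⟩
    simp only [one_smul, map_add] at this
    rw [hνg]; linarith
  obtain ⟨n₁, n₂, h1, h2, h12⟩ := D.planes p hp
  have hu := D.norm p hp
  have hfr : ∀ ν : E3, (∀ y ∈ interior K, ⟪ν, y - p⟫ < 0) → ∀ y ∈ frontier K, ⟪ν, y - p⟫ ≤ 0 :=
    fun ν h y hy => le_of_lt ν h y (frontier_subset D.body hy)
  obtain ⟨μ₁, hμ₁⟩ := exists_tangent hu h1.norm h1.orth h1.ellipse hp (pos ν hν) (hfr ν hν)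
  obtain ⟨μ₂, hμ₂⟩ := exists_tangent hu h2.norm h2.orth h2.ellipse hp (pos ν hν) (hfr ν hν)
  have hdet := frame_det_ne_zero hu h1.orth h2.orth
    (cr_ne_zero_of_abs_lt h1.norm h2.norm (h12.trans_lt D.kappa))
  have hz : ⟪ν', Ψ p⟫ • ν - ⟪ν, Ψ p⟫ • ν' = 0 := by
    refine eq_zero_of_inner hdet ?_ ?_ ?_
    · rw [real_inner_comm, inner_sub_left, inner_smul_left, inner_smul_left]
      simp; ring
    · rw [real_inner_comm, inner_sub_left, inner_smul_left, inner_smul_left, hμ₁ ν (hfr ν hν),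
        hμ₁ ν' (hfr ν' hν')]
      simp; ring
    · rw [real_inner_comm, inner_sub_left, inner_smul_left, inner_smul_left, hμ₂ ν (hfr ν hν),
        hμ₂ ν' (hfr ν' hν')]
      simp; ring
  have h5 := congrArg (fun z => ⟪z, w⟫) hz
  simp only [inner_sub_left, inner_smul_left, inner_zero_left, RCLike.conj_to_real] at h5
  have h6 := pos ν hν
  have h7 := pos ν' hν'
  nlinarith [mul_neg_of_pos_of_neg h7 hw, mul_nonneg h6.le hw']

theorem OutwardData.tendsto {K : Set E3} {Ψ : E3 → E3} {κ : ℝ} (D : OutwardData K Ψ κ)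
    {p : E3} {b : ℕ → E3} (hp : p ∈ frontier K) (hb : ∀ n, b n ∈ frontier K)
    (hbp : Tendsto b atTop (𝓝 p)) : Tendsto (fun n => Ψ (b n)) atTop (𝓝 (Ψ p)) :=
  (D.cont p hp).tendsto.comp (tendsto_nhdsWithin_iff.2 ⟨hbp, Eventually.of_forall hb⟩)

/-- Subsequential limits of pairs of unit normals. -/
theorem OutwardData.exists_subseq {K : Set E3} {Ψ : E3 → E3} {κ : ℝ} (D : OutwardData K Ψ κ)
    {p : E3} {b n₁ n₂ : ℕ → E3} (hp : p ∈ frontier K) (hb : ∀ n, b n ∈ frontier K)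
    (hbp : Tendsto b atTop (𝓝 p)) (h₁ : ∀ n, EllipticNormal K Ψ (b n) (n₁ n))
    (h₂ : ∀ n, EllipticNormal K Ψ (b n) (n₂ n)) (h₁₂ : ∀ n, |⟪n₁ n, n₂ n⟫| ≤ κ) :
    ∃ (φ : ℕ → ℕ) (a₁ a₂ : E3), StrictMono φ ∧ Tendsto (fun n => n₁ (φ n)) atTop (𝓝 a₁) ∧
      Tendsto (fun n => n₂ (φ n)) atTop (𝓝 a₂) ∧ ‖a₁‖ = 1 ∧ ‖a₂‖ = 1 ∧ ⟪a₁, Ψ p⟫ = 0 ∧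
      ⟪a₂, Ψ p⟫ = 0 ∧ |⟪a₁, a₂⟫| ≤ κ := by
  obtain ⟨⟨a₁, a₂⟩, ha, φ, hφ, hlim⟩ :=
    ((isCompact_sphere (0 : E3) 1).prod (isCompact_sphere (0 : E3) 1)).tendsto_subseq
      (x := fun n => (n₁ n, n₂ n)) (fun n => by simp [(h₁ n).norm, (h₂ n).norm])
  have l1 : Tendsto (fun n => n₁ (φ n)) atTop (𝓝 a₁) := (continuous_fst.tendsto _).comp hlim
  have l2 : Tendsto (fun n => n₂ (φ n)) atTop (𝓝 a₂) := (continuous_snd.tendsto _).comp hlim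
  have hΨ := (D.tendsto hp hb hbp).comp hφ.tendsto_atTop
  have orth : ∀ (m : ℕ → E3) (a : E3), (∀ n, EllipticNormal K Ψ (b n) (m n)) →
      Tendsto (fun n => m (φ n)) atTop (𝓝 a) → ⟪a, Ψ p⟫ = 0 := by
    intro m a hm hl
    refine tendsto_nhds_unique (hl.inner hΨ) ?_
    simp only [Function.comp_apply, (hm _).orth]
    exact tendsto_const_nhds
  refine ⟨φ, a₁, a₂, hφ, l1, l2, by simpa using ha.1, by simpa using ha.2, orth _ _ h₁ l1,
    orth _ _ h₂ l2, ?_⟩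
  exact le_of_tendsto (l1.inner l2).abs (Eventually.of_forall fun n => h₁₂ _)

/-- If an arc of the limiting section is forced into an open set where `f` vanishes, then `f`
vanishes on the nearby sections. -/
theorem frequently_eq_zero {K O : Set E3} {Ψ : E3 → E3} {κ : ℝ} (D : OutwardData K Ψ κ)
    {f : E3 → ℝ} (hf : IsQuad f) (hO : IsOpen O) (h0 : ∀ y ∈ O ∩ frontier K, f y = 0)
    {p a : E3} {b N : ℕ → E3} (hp : p ∈ frontier K) (hb : ∀ n, b n ∈ frontier K)
    (hbp : Tendsto b atTop (𝓝 p)) (hN : ∀ n, EllipticNormal K Ψ (b n) (N n))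
    (hNa : Tendsto N atTop (𝓝 a)) {σ μ t ε : ℝ} (hε : 0 ≤ ε)
    (hin : p + t • (σ • (cr (Ψ p) a - μ • Ψ p)) + (-ε) • (t • Ψ p) ∈ interior K)
    (hout : p + t • (σ • (cr (Ψ p) a - μ • Ψ p)) + ε • (t • Ψ p) ∉ K)
    (harc : ∀ r ∈ Set.Icc (-ε) ε, p + t • (σ • (cr (Ψ p) a - μ • Ψ p)) + r • (t • Ψ p) ∈ O) :
    ∃ n, f (b n) = 0 := by
  have hΨ := D.tendsto hp hb hbp
  set v := fun n => t • (σ • (cr (Ψ (b n)) (N n) - μ • Ψ (b n))) with hv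
  have hx : Tendsto (fun n => b n + v n) atTop (𝓝 (p + t • (σ • (cr (Ψ p) a - μ • Ψ p)))) :=
    hbp.add ((((hΨ.cr hNa).sub (hΨ.const_smul μ)).const_smul σ).const_smul t)
  have hd : Tendsto (fun n => t • Ψ (b n)) atTop (𝓝 (t • Ψ p)) := hΨ.const_smul t
  have e1 := (hx.add (hd.const_smul (-ε))).eventually (isOpen_interior.mem_nhds hin)
  have e2 := (hx.add (hd.const_smul ε)).eventually
    (D.body.1.isClosed.isOpen_compl.mem_nhds hout)
  obtain ⟨n₀, hn₀⟩ := eventually_atTop.1 (e1.and e2)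
  have hsel : ∀ n, ∃ r ∈ Set.Icc (-ε) ε,
      b (n + n₀) + v (n + n₀) + r • (t • Ψ (b (n + n₀))) ∈ frontier K := fun n =>
    exists_frontier_segment (by linarith) (interior_subset (hn₀ (n + n₀) (by omega)).1)
      (hn₀ (n + n₀) (by omega)).2
  choose r hr hrK using hsel
  obtain ⟨r₀, hr₀, φ, hφ, hlim⟩ := isCompact_Icc.tendsto_subseq hr
  have hsh : Tendsto (fun n => φ n + n₀) atTop atTop :=
    tendsto_atTop_mono (fun n => Nat.le_add_right _ _) hφ.tendsto_atTop
  have hz := (hx.comp hsh).add (hlim.smul (hd.comp hsh))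
  obtain ⟨n, hn⟩ := (hz.eventually (hO.mem_nhds (harc r₀ hr₀))).exists
  refine ⟨φ n + n₀, ellipse_arc (hN (φ n + n₀)).ellipse hf hO (z := _) ⟨hrK (φ n), ?_⟩ hn
    (fun y hy => h0 y ⟨hy.2, hy.1.1⟩) ⟨hb _, by simp⟩⟩
  simp only [hv, Set.mem_ofPred_eq, inner_sub_right, inner_add_right, inner_smul_right,
    (hN _).orth, inner_cr_right]
  ring

theorem exists_transversal {K : Set E3} {Ψ : E3 → E3} {κ : ℝ} (D : OutwardData K Ψ κ)
    {p o a₁ a₂ η ν : E3} (hp : p ∈ frontier K) (ho : ⟪ν, o - p⟫ < 0) (hνu : 0 < ⟪ν, Ψ p⟫)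
    (ha₁ : ‖a₁‖ = 1) (ha₂ : ‖a₂‖ = 1) (h₁ : ⟪a₁, Ψ p⟫ = 0) (h₂ : ⟪a₂, Ψ p⟫ = 0)
    (h₁₂ : |⟪a₁, a₂⟫| ≤ κ) (hη : η ≠ 0) (hηo : ⟪η, p - o⟫ = 0) :
    ⟪η, cr (Ψ p) a₁⟫ - ⟪ν, cr (Ψ p) a₁⟫ / ⟪ν, Ψ p⟫ * ⟪η, Ψ p⟫ ≠ 0 ∨
      ⟪η, cr (Ψ p) a₂⟫ - ⟪ν, cr (Ψ p) a₂⟫ / ⟪ν, Ψ p⟫ * ⟪η, Ψ p⟫ ≠ 0 := by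
  by_contra hcon
  push Not at hcon
  obtain ⟨e1, e2⟩ := hcon
  have hdet := frame_det_ne_zero (D.norm p hp) h₁ h₂
    (cr_ne_zero_of_abs_lt ha₁ ha₂ (h₁₂.trans_lt D.kappa))
  have hz : ⟪ν, Ψ p⟫ • η - ⟪η, Ψ p⟫ • ν = 0 := by
    field_simp at e1 e2
    refine eq_zero_of_inner hdet ?_ ?_ ?_
    · rw [real_inner_comm, inner_sub_left, inner_smul_left, inner_smul_left]
      simp; ring
    · rw [real_inner_comm, inner_sub_left, inner_smul_left, inner_smul_left]
      simp; linarith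
    · rw [real_inner_comm, inner_sub_left, inner_smul_left, inner_smul_left]
      simp; linarith
  have h5 := congrArg (fun z => ⟪z, p - o⟫) hz
  simp only [inner_sub_left, inner_smul_left, inner_zero_left, RCLike.conj_to_real, hηo] at h5
  rw [← neg_sub p o, inner_neg_right] at ho
  have h6 : ⟪η, Ψ p⟫ = 0 := by
    have : ⟪η, Ψ p⟫ * ⟪ν, p - o⟫ = 0 := by linarith
    exact (mul_eq_zero.1 this).resolve_right (by linarith)
  rw [h6, zero_smul, sub_zero] at hz
  exact (smul_ne_zero hνu.ne' hη) hz

/-- A quadric containing the part of the boundary in a cap bounded by a surface through `p`,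
whose normal at `p` is orthogonal to `p - o` with `o` interior, contains a neighbourhood of `p`. -/
theorem eventually_eq_zero_of_cap {K : Set E3} {Ψ : E3 → E3} {κ : ℝ} (D : OutwardData K Ψ κ)
    {f g : E3 → ℝ} (hf : IsQuad f) (hg : Continuous g) (h0 : ∀ y ∈ frontier K, 0 < g y → f y = 0)
    {p o η : E3} (hp : p ∈ frontier K) (ho : o ∈ interior K) (hη : η ≠ 0)
    (hηo : ⟪η, p - o⟫ = 0) {C : ℝ} (hC : 0 ≤ C) (hgη : ∀ w, ⟪η, w⟫ - C * ‖w‖ ^ 2 ≤ g (p + w)) :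
    ∀ᶠ y in 𝓝[frontier K] p, f y = 0 := by
  by_contra hcon
  obtain ⟨b, hbt, hb⟩ := exists_seq_forall_of_frequently (not_eventually.1 hcon)
  rw [tendsto_nhdsWithin_iff] at hbt
  obtain ⟨hbt, hbK'⟩ := hbt
  obtain ⟨n₀, hn₀⟩ := eventually_atTop.1 hbK'
  set b' := fun n => b (n + n₀) with hb'
  have hbK : ∀ n, b' n ∈ frontier K := fun n => hn₀ _ (by omega)
  have hbt' : Tendsto b' atTop (𝓝 p) := (tendsto_add_atTop_iff_nat n₀).2 hbt
  have hb0 : ∀ n, f (b' n) ≠ 0 := fun n => hb (n + n₀)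
  choose n₁ n₂ h₁ h₂ h₁₂ using fun n => D.planes (b' n) (hbK n)
  obtain ⟨φ, a₁, a₂, hφ, l₁, l₂, i₁, i₂, j₁, j₂, k⟩ := D.exists_subseq hp hbK hbt' h₁ h₂ h₁₂
  obtain ⟨ν, -, hνint, hνu, hνw⟩ := exists_smooth_support D hp
  have hbφ := hbt'.comp hφ.tendsto_atTop
  have main : ∀ (a : E3) (N : ℕ → E3), (∀ n, EllipticNormal K Ψ (b' n) (N n)) →
      Tendsto (fun n => N (φ n)) atTop (𝓝 a) →
      ⟪η, cr (Ψ p) a⟫ - ⟪ν, cr (Ψ p) a⟫ / ⟪ν, Ψ p⟫ * ⟪η, Ψ p⟫ = 0 := by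
    intro a N hN hNa
    by_contra hq
    set μ := ⟪ν, cr (Ψ p) a⟫ / ⟪ν, Ψ p⟫ with hμ
    set q := ⟪η, cr (Ψ p) a⟫ - μ * ⟪η, Ψ p⟫ with hqd
    set v := q • (cr (Ψ p) a - μ • Ψ p) with hv
    have hηv : ⟪η, v⟫ = q ^ 2 := by
      rw [hv, inner_smul_right, inner_sub_right, inner_smul_right, ← hqd]; ring
    have hνv : ⟪ν, v⟫ = 0 := by
      rw [hv, inner_smul_right, inner_sub_right, inner_smul_right, hμ]
      field_simp
      ring
    have hq2 : 0 < q ^ 2 := by positivity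
    set ε := q ^ 2 / (2 * (|⟪η, Ψ p⟫| + 1)) with hε
    have hε0 : 0 < ε := by positivity
    have hεq : ε * |⟪η, Ψ p⟫| ≤ q ^ 2 / 2 := by
      rw [hε, div_mul_eq_mul_div, div_le_div_iff₀ (by positivity) (by positivity)]
      nlinarith [abs_nonneg ⟪η, Ψ p⟫]
    obtain ⟨t₁, ht₁, hin⟩ := hνw (v - ε • Ψ p) (by
      rw [inner_sub_right, inner_smul_right _ (Ψ p), hνv]; nlinarith)
    set M := ‖v‖ + ε with hM
    set t := min t₁ (q ^ 2 / 2 / (C * M ^ 2 + 1)) with ht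
    have ht0 : 0 < t := lt_min ht₁ (by positivity)
    have htM : t * (C * M ^ 2 + 1) ≤ q ^ 2 / 2 := by
      rw [← le_div_iff₀ (by positivity)]; exact min_le_right _ _
    have hin' : p + t • v + (-ε) • (t • Ψ p) ∈ interior K := by
      have h1 : t / t₁ ≤ 1 := (div_le_one ht₁).2 (min_le_left _ _)
      have := D.body.2.1.combo_self_interior_mem_interior (frontier_subset D.body hp) hin
        (a := 1 - t / t₁) (b := t / t₁) (by linarith) (by positivity) (by ring)
      convert this using 1
      have h2 : t = t / t₁ * t₁ := by field_simp
      rw [smul_add, smul_smul (t / t₁), ← h2]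
      module
    have hout : p + t • v + ε • (t • Ψ p) ∉ K := by
      intro hK
      have hcl : K ⊆ closure (interior K) := by
        rw [D.body.2.1.closure_interior_eq_closure_of_nonempty_interior D.body.2.2]
        exact subset_closure
      have hc : IsClosed {y : E3 | ⟪ν, y - p⟫ ≤ 0} := isClosed_le (by fun_prop) continuous_const
      have h3 := hc.closure_subset_iff.2 (fun z hz => (hνint z hz).le) (hcl hK)
      simp only [Set.mem_ofPred_eq, add_assoc, add_sub_cancel_left, inner_add_right,
        inner_smul_right, hνv] at h3
      have : 0 < ε * (t * ⟪ν, Ψ p⟫) := by positivity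
      linarith
    obtain ⟨n, hn⟩ := frequently_eq_zero D hf (O := {y | 0 < g y}) (isOpen_lt continuous_const hg)
      (fun y hy => h0 y hy.2 hy.1) hp (fun n => hbK (φ n)) hbφ (fun n => hN (φ n)) hNa
      (σ := q) (μ := μ) (t := t) hε0.le hin' hout (by
        intro r hr
        have hr' : |r| ≤ ε := abs_le.2 hr
        have h4 := hgη (t • (v + r • Ψ p))
        have h5 : ‖v + r • Ψ p‖ ≤ M := by
          refine (norm_add_le _ _).trans ?_
          rw [norm_smul r (Ψ p), D.norm p hp, mul_one, Real.norm_eq_abs]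
          linarith
        have h6 : q ^ 2 / 2 ≤ ⟪η, v + r • Ψ p⟫ := by
          rw [inner_add_right, inner_smul_right _ (Ψ p), hηv]
          have : |r * ⟪η, Ψ p⟫| ≤ ε * |⟪η, Ψ p⟫| := by
            rw [abs_mul]; gcongr
          have := neg_abs_le (r * ⟪η, Ψ p⟫)
          linarith
        rw [inner_smul_right, norm_smul, Real.norm_of_nonneg ht0.le] at h4
        have h7 : ‖v + r • Ψ p‖ ^ 2 ≤ M ^ 2 := by gcongr
        have h8 : C * ‖v + r • Ψ p‖ ^ 2 ≤ C * M ^ 2 := by gcongr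
        have h9 : 0 < t * (⟪η, v + r • Ψ p⟫ - t * (C * ‖v + r • Ψ p‖ ^ 2)) := by
          apply mul_pos ht0
          nlinarith
        have h10 : p + t • v + r • (t • Ψ p) = p + t • (v + r • Ψ p) := by module
        change 0 < g (p + t • v + r • (t • Ψ p))
        rw [h10]
        linarith)
    exact hb0 _ hn
  have ho' := hνint o ho
  rcases exists_transversal D hp ho' hνu i₁ i₂ j₁ j₂ k hη hηo with h | h
  · exact h (main a₁ n₁ h₁ l₁)
  · exact h (main a₂ n₂ h₂ l₂)

theorem frontier_ray_unique {K : Set E3} (hK : IsConvexBody K) {o y p : E3} (ho : o ∈ interior K)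
    (hy : y ∈ frontier K) (hp : p ∈ frontier K) {r : ℝ} (hr : 0 < r) (h : y - o = r • (p - o)) :
    y = p := by
  have hyr : o + r • (p - o) = y := by rw [← h]; abel
  rcases lt_trichotomy r 1 with h1 | h1 | h1
  · have := interior_of_lt_one hK ho (w := p - o) (by simpa using frontier_subset hK hp) hr.le h1
    rw [hyr] at this
    exact absurd this (not_mem_interior_of_frontier hy)
  · rw [h1, one_smul] at h
    exact sub_left_injective h
  · have := not_mem_of_one_lt hK ho (w := p - o) (by simpa using hp) h1
    rw [hyr] at this
    exact absurd (frontier_subset hK hy) this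

theorem norm_add_bounds {ρ : E3} (hρ : ρ ≠ 0) (w : E3) :
    0 ≤ ‖ρ + w‖ - ‖ρ‖ - ⟪ρ, w⟫ / ‖ρ‖ ∧
      ‖ρ + w‖ - ‖ρ‖ - ⟪ρ, w⟫ / ‖ρ‖ ≤ ‖w‖ ^ 2 / (2 * ‖ρ‖) := by
  have hR : 0 < ‖ρ‖ := norm_pos_iff.2 hρ
  have h1 := norm_add_sq_real ρ w
  have h2 := real_inner_le_norm ρ (ρ + w)
  rw [inner_add_right, real_inner_self_eq_norm_sq] at h2
  constructor
  · have : ‖ρ + w‖ - ‖ρ‖ - ⟪ρ, w⟫ / ‖ρ‖ = (‖ρ‖ * ‖ρ + w‖ - (‖ρ‖ ^ 2 + ⟪ρ, w⟫)) / ‖ρ‖ := by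
      field_simp; ring
    rw [this]
    exact div_nonneg (by linarith) hR.le
  · have : ‖w‖ ^ 2 / (2 * ‖ρ‖) - (‖ρ + w‖ - ‖ρ‖ - ⟪ρ, w⟫ / ‖ρ‖) =
        (‖ρ + w‖ - ‖ρ‖) ^ 2 / (2 * ‖ρ‖) := by
      field_simp; linear_combination -h1
    have : 0 ≤ (‖ρ + w‖ - ‖ρ‖) ^ 2 / (2 * ‖ρ‖) := by positivity
    linarith

theorem IsEllipse.exists_ne {E : Set E3} (hE : IsEllipse E) (p : E3) : ∃ z ∈ E, z ≠ p := by
  obtain ⟨o, a, b, h1, -, h3, -⟩ := hE.exists_param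
  by_contra hcon
  push Not at hcon
  have e1 := hcon _ (h1 1 0 (by norm_num))
  have e2 := hcon _ (h1 (-1) 0 (by norm_num))
  have := h3 2 0 (by
    have h4 := e1.trans e2.symm
    have h5 := sub_eq_zero.2 h4
    rw [← h5]; module)
  norm_num at this

/-- A quadric containing a relatively open part of the boundary contains the boundary. -/
theorem quadric_extends {K : Set E3} {Ψ : E3 → E3} {κ : ℝ} (D : OutwardData K Ψ κ)
    {f : E3 → ℝ} (hf : IsQuad f) {U : Set E3} (hU : IsOpen U) (hUK : (U ∩ frontier K).Nonempty)
    (hfU : ∀ y ∈ U ∩ frontier K, f y = 0) : ∀ y ∈ frontier K, f y = 0 := by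
  by_contra hcon
  push Not at hcon
  obtain ⟨y₀, hy₀, hfy₀⟩ := hcon
  set O : Set E3 := {y | ∀ᶠ z in 𝓝[frontier K] y, f z = 0} with hOdef
  have hO : IsOpen O := by
    rw [isOpen_iff_mem_nhds]
    intro y hy
    have := eventually_nhdsWithin_iff.1 hy
    filter_upwards [eventually_eventually_nhds.2 this] with z hz
    exact eventually_nhdsWithin_iff.2 hz
  have hO0 : ∀ y ∈ frontier K, y ∈ O → f y = 0 := fun y hy hyO =>
    Eventually.self_of_nhdsWithin (p := fun z => f z = 0) hyO hy
  obtain ⟨o, ho⟩ := D.body.2.2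
  obtain ⟨p₀, hp₀U, hp₀⟩ := hUK
  have hp₀O : p₀ ∈ O := by
    have : U ∈ 𝓝[frontier K] p₀ := mem_nhdsWithin_of_mem_nhds (hU.mem_nhds hp₀U)
    filter_upwards [this, self_mem_nhdsWithin] with z hz hz'
    exact hfU z ⟨hz, hz'⟩
  have hfro : ∀ y ∈ frontier K, y - o ≠ 0 := by
    intro y hy h
    rw [sub_eq_zero.1 h] at hy
    exact not_mem_interior_of_frontier hy ho
  have hcomp : IsCompact (frontier K \ O) :=
    (D.body.1.of_isClosed_subset isClosed_frontier (fun y hy => frontier_subset D.body hy)).diff hO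
  set e := p₀ - o with he
  have he0 : e ≠ 0 := hfro p₀ hp₀
  obtain ⟨p, ⟨hp, hpO⟩, hmax⟩ := hcomp.exists_isMaxOn ⟨y₀, hy₀, fun h => hfy₀ (hO0 _ hy₀ h)⟩
    (f := fun y => ⟪y - o, e⟫ / ‖y - o‖) (ContinuousOn.div (by fun_prop) (by fun_prop)
      (fun y hy => norm_ne_zero_iff.2 (hfro y hy.1)))
  set ρ := p - o with hρ
  have hρ0 : ρ ≠ 0 := hfro p hp
  have hR : 0 < ‖ρ‖ := norm_pos_iff.2 hρ0
  set c := ⟪ρ, e⟫ / ‖ρ‖ with hc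
  have hcR : ⟪ρ, e⟫ = c * ‖ρ‖ := by rw [hc]; field_simp
  have hmax' : ∀ y ∈ frontier K, y ∉ O → ⟪y - o, e⟫ ≤ c * ‖y - o‖ := by
    intro y hy hyO
    have := hmax (show y ∈ frontier K \ O from ⟨hy, hyO⟩)
    exact (div_le_iff₀ (norm_pos_iff.2 (hfro y hy))).1 this
  by_cases hη : e - (c / ‖ρ‖) • ρ = 0
  · have heρ : e = (c / ‖ρ‖) • ρ := sub_eq_zero.1 hη
    rcases lt_trichotomy c 0 with h | h | h
    · have hN : ∀ y ∈ frontier K, y ≠ p → f y = 0 := by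
        intro y hy hyp
        refine hO0 y hy ?_
        by_contra hyO
        apply hyp
        have h1 := hmax' y hy hyO
        rw [heρ, inner_smul_right, div_mul_eq_mul_div, div_le_iff₀ hR, mul_assoc] at h1
        have h2 := (mul_le_mul_left_of_neg h).1 h1
        have h3 : ⟪y - o, ρ⟫ = ‖y - o‖ * ‖ρ‖ := le_antisymm (real_inner_le_norm _ _) h2
        have h4 := inner_eq_norm_mul_iff_real.1 h3
        refine frontier_ray_unique D.body ho hy hp (r := ‖y - o‖ / ‖ρ‖)
          (div_pos (norm_pos_iff.2 (hfro y hy)) hR) ?_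
        rw [← hρ, div_eq_inv_mul, mul_smul, ← h4, smul_smul, inv_mul_cancel₀ hR.ne', one_smul]
      obtain ⟨n, -, hn, -, -⟩ := D.planes p hp
      obtain ⟨z, hz, hzp⟩ := hn.ellipse.exists_ne p
      have hfp : f p = 0 := ellipse_arc hn.ellipse hf (isOpen_compl_singleton (x := p)) hz hzp
        (fun y hy => hN y hy.1.1 hy.2) ⟨hp, by simp⟩
      rcases eq_or_ne y₀ p with h1 | h1
      · exact hfy₀ (h1 ▸ hfp)
      · exact hfy₀ (hN y₀ hy₀ h1)
    · rw [h, zero_div, zero_smul] at heρ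
      exact he0 heρ
    · have := frontier_ray_unique D.body ho hp₀ hp (div_pos h hR) heρ
      exact hpO (this ▸ hp₀O)
  · refine hpO (eventually_eq_zero_of_cap D hf (g := fun y => ⟪y - o, e⟫ - c * ‖y - o‖)
      (by fun_prop) ?_ hp ho hη (C := |c| / (2 * ‖ρ‖)) ?_ (by positivity) fun w => ?_)
    · intro y hy hgy
      refine hO0 y hy ?_
      by_contra hyO
      have := hmax' y hy hyO
      linarith
    · rw [← hρ, inner_sub_left, inner_smul_left, real_inner_self_eq_norm_sq, real_inner_comm, hcR]
      simp only [RCLike.conj_to_real]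
      field_simp
      ring
    · obtain ⟨b1, b2⟩ := norm_add_bounds hρ0 w
      have h1 : p + w - o = ρ + w := by rw [hρ]; abel
      rw [h1, inner_add_left, hcR, inner_sub_left, inner_smul_left, real_inner_comm w e]
      simp only [RCLike.conj_to_real]
      have h2 : c * (‖ρ + w‖ - ‖ρ‖ - ⟪ρ, w⟫ / ‖ρ‖) ≤ |c| * (‖w‖ ^ 2 / (2 * ‖ρ‖)) :=
        (mul_le_mul_of_nonneg_right (le_abs_self c) b1).trans
          (mul_le_mul_of_nonneg_left b2 (abs_nonneg c))
      have h3 : c / ‖ρ‖ * ⟪ρ, w⟫ = c * (⟪ρ, w⟫ / ‖ρ‖) := by ring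
      have h4 : |c| / (2 * ‖ρ‖) * ‖w‖ ^ 2 = |c| * (‖w‖ ^ 2 / (2 * ‖ρ‖)) := by ring
      rw [h3, h4]
      linarith

/-! ### The topological obstruction -/

theorem eq_of_exp_const {f : ℝ → ℂ} (hf : Continuous f) {c : ℂ} (h : ∀ t, Complex.exp (f t) = c)
    (t s : ℝ) : f t = f s := by
  have := Complex.isCoveringMap_exp.eq_of_comp_eq hf (continuous_const (y := f s))
    (by ext t; simp [h]) s rfl
  exact congrFun this t

/-- There is no continuous nonvanishing function on the annulus with different degrees at the
two ends. -/
theorem no_twist {G : ℝ × ℝ → ℂ} (hG : Continuous G) (h0 : ∀ x, G x ≠ 0)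
    (hper : ∀ s, G (s, 2 * Real.pi) = G (s, 0)) {k k' : ℂ} {s₀ s₁ : ℝ}
    (hk : ∀ θ : ℝ, G (s₀, θ) = k * Complex.exp (-(4 * θ * Complex.I)))
    (hk' : ∀ θ : ℝ, G (s₁, θ) = k' * Complex.exp (4 * θ * Complex.I)) : False := by
  have hsc : IsSimplyConnected (Set.univ : Set (ℝ × ℝ)) := by
    have := (convex_univ (𝕜 := ℝ) (E := ℝ × ℝ)).contractibleSpace Set.univ_nonempty
    exact SimplyConnectedSpace.ofContractible _
  obtain ⟨L, hL, hLG⟩ := Complex.exists_continuousOn_eqOn_exp_comp hsc isOpen_univ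
    hG.continuousOn (by simp [h0])
  rw [continuousOn_univ] at hL
  have hexp : ∀ x, Complex.exp (L x) = G x := fun x => hLG (Set.mem_univ x)
  have e1 := eq_of_exp_const (f := fun s => L (s, 2 * Real.pi) - L (s, 0)) (by fun_prop) (c := 1)
    (fun s => by rw [Complex.exp_sub, hexp, hexp, hper, div_self (h0 _)]) s₀ s₁
  have e2 := eq_of_exp_const (f := fun θ : ℝ => L (s₀, θ) + 4 * θ * Complex.I) (by fun_prop)
    (c := k) (fun θ => by
      rw [Complex.exp_add, hexp, hk, mul_assoc, ← Complex.exp_add]; simp) (2 * Real.pi) 0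
  have e3 := eq_of_exp_const (f := fun θ : ℝ => L (s₁, θ) - 4 * θ * Complex.I) (by fun_prop)
    (c := k') (fun θ => by
      rw [Complex.exp_sub, hexp, hk', mul_div_assoc, div_self (Complex.exp_ne_zero _), mul_one])
    (2 * Real.pi) 0
  have h1 := congrArg Complex.im e1
  have h2 := congrArg Complex.im e2
  have h3 := congrArg Complex.im e3
  simp at h1 h2 h3
  linarith [Real.pi_pos]


/-- A map taking the plane orthogonal to `u` to the plane orthogonal to `e`. -/
def tilt (u e n : E3) : E3 := (1 + ⟪u, e⟫) • n - ⟪n, e⟫ • (u + e)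

theorem inner_tilt {u e : E3} (he : ‖e‖ = 1) (n : E3) : ⟪tilt u e n, e⟫ = 0 := by
  rw [tilt, inner_sub_left, inner_smul_left, inner_smul_left, inner_add_left, inner_self_one he]
  simp only [RCLike.conj_to_real]
  ring

theorem tilt_ne_zero {u e n : E3} (hn : ‖n‖ = 1) (hnu : ⟪n, u⟫ = 0)
    (hue : 1 + ⟪u, e⟫ ≠ 0) (hu : ‖u‖ = 1) : tilt u e n ≠ 0 := by
  intro h
  have h1 := congrArg (fun z => ⟪n, z⟫) h
  have h2 := congrArg (fun z => ⟪u, z⟫) h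
  simp only [tilt, inner_sub_right, inner_smul_right, inner_add_right, inner_self_one hn,
    inner_self_one hu, hnu, real_inner_comm n u, inner_zero_right] at h1 h2
  have h3 : ⟪n, e⟫ = 0 := by
    have : ⟪n, e⟫ * (1 + ⟪u, e⟫) = 0 := by linarith
    exact (mul_eq_zero.1 this).resolve_right hue
  rw [h3] at h1
  apply hue
  linarith

/-- The vector with coordinates `⟪w, a⟫` and `⟪w, b⟫`, as a complex number. -/
def toPlane (a b w : E3) : ℂ := ⟪w, a⟫ + ⟪w, b⟫ * Complex.I

/-- An invariant of the unordered pair of lines spanned by `n` and `n'`. -/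
def twist (u e a b n n' : E3) : ℂ := toPlane a b (tilt u e n) ^ 2 * toPlane a b (tilt u e n') ^ 2

theorem continuous_twist : Continuous fun z : E3 × E3 × E3 × E3 × E3 × E3 =>
    twist z.1 z.2.1 z.2.2.1 z.2.2.2.1 z.2.2.2.2.1 z.2.2.2.2.2 := by
  unfold twist toPlane tilt
  fun_prop

theorem twist_comm (u e a b n n' : E3) : twist u e a b n n' = twist u e a b n' n := by
  unfold twist; ring

theorem twist_neg (u e a b n n' : E3) : twist u e a b (-n) n' = twist u e a b n n' := by
  have : tilt u e (-n) = -tilt u e n := by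
    unfold tilt; rw [inner_neg_left]; module
  simp only [twist, this, toPlane, inner_neg_left]
  push_cast; ring

theorem twist_congr {u e a b n n' m m' : E3} (h : n = m ∨ n = -m) (h' : n' = m' ∨ n' = -m') :
    twist u e a b n n' = twist u e a b m m' := by
  rcases h with rfl | rfl <;> rcases h' with rfl | rfl
  · rfl
  · rw [twist_comm, twist_neg, twist_comm]
  · rw [twist_neg]
  · rw [twist_neg, twist_comm, twist_neg, twist_comm]

theorem twist_eq {u e a b n n' m m' : E3} (hm : ‖m‖ = 1) (hm' : ‖m'‖ = 1) (hn : ‖n‖ = 1)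
    (hn' : ‖n'‖ = 1) (hmm : |⟪m, m'⟫| < 1) (h : cr m n = 0 ∨ cr m n' = 0)
    (h' : cr m' n = 0 ∨ cr m' n' = 0) : twist u e a b m m' = twist u e a b n n' := by
  have key : ∀ k : E3, ‖k‖ = 1 → cr m k = 0 → cr m' k = 0 → False := by
    intro k hk h1 h2
    rcases eq_or_neg_of_cr hm hk h1 with rfl | rfl <;>
      rcases eq_or_neg_of_cr hm' hk h2 with rfl | rfl <;>
      simp [hk] at hmm
  rcases h with h | h <;> rcases h' with h' | h'
  · exact (key n hn h h').elim
  · exact twist_congr (eq_or_neg_of_cr hm hn h) (eq_or_neg_of_cr hm' hn' h')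
  · rw [twist_comm u e a b n]
    exact twist_congr (eq_or_neg_of_cr hm hn' h) (eq_or_neg_of_cr hm' hn h')
  · exact (key n' hn' h h').elim

/-- The radial vector of spherical coordinates. -/
def sphR (x : ℝ × ℝ) : E3 :=
  !₂[Real.sin x.1 * Real.cos x.2, Real.sin x.1 * Real.sin x.2, Real.cos x.1]

/-- The polar tangent vector of spherical coordinates. -/
def sphS (x : ℝ × ℝ) : E3 :=
  !₂[Real.cos x.1 * Real.cos x.2, Real.cos x.1 * Real.sin x.2, -Real.sin x.1]

/-- The azimuthal tangent vector of spherical coordinates. -/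
def sphT (x : ℝ × ℝ) : E3 := !₂[-Real.sin x.2, Real.cos x.2, 0]

theorem continuous_sphR : Continuous sphR := by unfold sphR; fun_prop

theorem continuous_sphS : Continuous sphS := by unfold sphS; fun_prop

theorem continuous_sphT : Continuous sphT := by unfold sphT; fun_prop

theorem cr_sph (x : ℝ × ℝ) : cr (sphS x) (sphT x) = sphR x := by
  apply ext_E3 <;> simp [sphR, sphS, sphT]
  linear_combination Real.cos x.1 * Real.sin_sq_add_cos_sq x.2

theorem norm_sphR (x : ℝ × ℝ) : ‖sphR x‖ = 1 := by
  have : ‖sphR x‖ ^ 2 = 1 := by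
    rw [← real_inner_self_eq_norm_sq, inner_E3]
    simp [sphR]
    linear_combination Real.sin x.1 ^ 2 * Real.sin_sq_add_cos_sq x.2 + Real.sin_sq_add_cos_sq x.1
  nlinarith [norm_nonneg (sphR x)]

theorem toPlane_sph_ne_zero (x : ℝ × ℝ) {w : E3} (hw : w ≠ 0) (h : ⟪w, sphR x⟫ = 0) :
    toPlane (sphS x) (sphT x) w ≠ 0 := by
  intro h0
  have h1 := congrArg Complex.re h0
  have h2 := congrArg Complex.im h0
  simp [toPlane] at h1 h2
  refine hw (eq_zero_of_inner (a := sphR x) (b := sphS x) (c := sphT x) ?_ ?_ ?_ ?_)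
  · rw [cr_sph, inner_self_one (norm_sphR x)]; exact one_ne_zero
  all_goals rwa [real_inner_comm]

theorem toPlane_north (w : E3) (θ : ℝ) : toPlane (sphS (0, θ)) (sphT (0, θ)) w =
    (w 0 + w 1 * Complex.I) * Complex.exp (-(θ * Complex.I)) := by
  rw [← neg_mul, ← Complex.ofReal_neg, Complex.exp_mul_I, toPlane, inner_E3, inner_E3]
  simp [sphS, sphT]
  linear_combination ((w 1 : ℂ) * Complex.sin θ) * Complex.I_sq

theorem toPlane_south (w : E3) (θ : ℝ) : toPlane (sphS (Real.pi, θ)) (sphT (Real.pi, θ)) w =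
    (-w 0 + w 1 * Complex.I) * Complex.exp (θ * Complex.I) := by
  rw [Complex.exp_mul_I, toPlane, inner_E3, inner_E3]
  simp [sphS, sphT]
  linear_combination (-(w 1 : ℂ) * Complex.sin θ) * Complex.I_sq


theorem tendsto_twist {u e a b n n' : ℕ → E3} {u₀ e₀ a₀ b₀ n₀ n₀' : E3}
    (hu : Tendsto u atTop (𝓝 u₀)) (he : Tendsto e atTop (𝓝 e₀)) (ha : Tendsto a atTop (𝓝 a₀))
    (hb : Tendsto b atTop (𝓝 b₀)) (hn : Tendsto n atTop (𝓝 n₀))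
    (hn' : Tendsto n' atTop (𝓝 n₀')) :
    Tendsto (fun i => twist (u i) (e i) (a i) (b i) (n i) (n' i)) atTop
      (𝓝 (twist u₀ e₀ a₀ b₀ n₀ n₀')) := by
  have h := (continuous_twist.tendsto (u₀, e₀, a₀, b₀, n₀, n₀')).comp (hu.prodMk_nhds
    (he.prodMk_nhds (ha.prodMk_nhds (hb.prodMk_nhds (hn.prodMk_nhds hn')))))
  exact h

theorem frontier_ray_tendsto {K : Set E3} (hK : IsConvexBody K) {o e q : E3} {r₀ : ℝ}
    {r : ℕ → ℝ} {v : ℕ → E3} (ho : o ∈ interior K) (hv : ∀ n, ‖v n‖ = 1)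
    (hve : Tendsto v atTop (𝓝 e)) (hr₀ : 0 < r₀) (hp : o + r₀ • e ∈ frontier K) (hr : ∀ n, 0 < r n) (hq : q ∈ frontier K)
    (hlim : Tendsto (fun n => o + r n • v n) atTop (𝓝 q)) : q = o + r₀ • e := by
  have h1 : Tendsto (fun n => r n • v n) atTop (𝓝 (q - o)) := by
    simpa using hlim.sub_const o
  have h2 : Tendsto r atTop (𝓝 ‖q - o‖) := by
    refine h1.norm.congr fun n => ?_
    rw [norm_smul, hv, mul_one, Real.norm_of_nonneg (hr n).le]
  have h3 : q - o = ‖q - o‖ • e := tendsto_nhds_unique h1 (h2.smul hve)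
  have h4 : q - o ≠ 0 := by
    intro h
    rw [sub_eq_zero] at h
    exact not_mem_interior_of_frontier hq (h ▸ ho)
  refine frontier_ray_unique hK ho hq hp (div_pos (norm_pos_iff.2 h4) hr₀) ?_
  rw [add_sub_cancel_left, smul_smul, div_mul_cancel₀ _ hr₀.ne']
  exact h3

/-- Some boundary point has three distinct normals to conic sections. -/
theorem OutwardData.exists_three_conic {K : Set E3} {Ψ : E3 → E3} {κ : ℝ}
    (D : OutwardData K Ψ κ) : ∃ p ∈ frontier K, ∃ m : Fin 3 → E3, (∀ i, ‖m i‖ = 1) ∧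
      (∀ i, ⟪m i, Ψ p⟫ = 0) ∧ (∀ i j, i ≠ j → cr (m i) (m j) ≠ 0) ∧
      ∀ i, ConicNormal K Ψ p (m i) := by
  by_contra hcon
  have alt : ∀ p ∈ frontier K, ∀ n₁ n₂ a : E3, EllipticNormal K Ψ p n₁ →
      EllipticNormal K Ψ p n₂ → |⟪n₁, n₂⟫| ≤ κ → ‖a‖ = 1 → ⟪a, Ψ p⟫ = 0 →
      ConicNormal K Ψ p a → cr a n₁ = 0 ∨ cr a n₂ = 0 := by
    intro p hp n₁ n₂ a h₁ h₂ h₁₂ ha hau hc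
    by_contra! hne
    have h12 := cr_ne_zero_of_abs_lt h₁.norm h₂.norm (h₁₂.trans_lt D.kappa)
    have hsw : ∀ x y : E3, cr x y ≠ 0 → cr y x ≠ 0 := fun x y h => by
      rw [cr_anticomm]; exact neg_ne_zero.2 h
    refine hcon ⟨p, hp, ![n₁, n₂, a], ?_, ?_, ?_, ?_⟩
    · intro i; fin_cases i
      exacts [h₁.norm, h₂.norm, ha]
    · intro i; fin_cases i
      exacts [h₁.orth, h₂.orth, hau]
    · intro i j hij
      fin_cases i <;> fin_cases j <;> first | exact absurd rfl hij | skip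
      exacts [h12, hsw _ _ hne.1, hsw _ _ h12, hsw _ _ hne.2, hne.1, hne.2]
    · intro i; fin_cases i
      exacts [h₁.conic (D.norm p hp), h₂.conic (D.norm p hp), hc]
  obtain ⟨o, ho⟩ := D.body.2.2
  have hex : ∀ e : E3, ∃ (r : ℝ) (n₁ n₂ : E3), ‖e‖ = 1 → 0 < r ∧ o + r • e ∈ frontier K ∧
      EllipticNormal K Ψ (o + r • e) n₁ ∧ EllipticNormal K Ψ (o + r • e) n₂ ∧
      |⟪n₁, n₂⟫| ≤ κ := by
    intro e
    by_cases he : ‖e‖ = 1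
    · obtain ⟨r, hr, hp⟩ := exists_ray_frontier D.body ho (d := e) (by rintro rfl; simp at he)
      obtain ⟨n₁, n₂, h⟩ := D.planes _ hp
      exact ⟨r, n₁, n₂, fun _ => ⟨hr, hp, h⟩⟩
    · exact ⟨0, 0, 0, fun h => absurd h he⟩
  choose r n₁ n₂ hrn using hex
  have hR := fun x : ℝ × ℝ => hrn (sphR x) (norm_sphR x)
  set g : ℝ × ℝ → E3 := fun x => o + r (sphR x) • sphR x with hg
  have hper : ∀ s : ℝ, sphR (s, 2 * Real.pi) = sphR (s, 0) ∧
      sphS (s, 2 * Real.pi) = sphS (s, 0) ∧ sphT (s, 2 * Real.pi) = sphT (s, 0) := by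
    intro s
    simp [sphR, sphS, sphT]
  have hpole : ∀ (s θ : ℝ), Real.sin s = 0 → sphR (s, θ) = sphR (s, 0) := by
    intro s θ h
    simp [sphR, h]
  obtain ⟨k, hk⟩ : ∃ k : ℂ, ∀ θ : ℝ, twist (Ψ (g (0, θ))) (sphR (0, θ)) (sphS (0, θ))
      (sphT (0, θ)) (n₁ (sphR (0, θ))) (n₂ (sphR (0, θ))) =
        k * Complex.exp (-(4 * θ * Complex.I)) := by
    refine ⟨?_, fun θ => ?_⟩
    rotate_left
    have h := hpole 0 θ Real.sin_zero
    simp only [twist, hg, h, toPlane_north]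
    rw [show -(4 * (θ : ℂ) * Complex.I) = (4 : ℕ) * (-(θ * Complex.I)) by push_cast; ring,
      Complex.exp_nat_mul, mul_pow, mul_pow, mul_mul_mul_comm, ← pow_add]
  obtain ⟨k', hk'⟩ : ∃ k : ℂ, ∀ θ : ℝ, twist (Ψ (g (Real.pi, θ))) (sphR (Real.pi, θ))
      (sphS (Real.pi, θ)) (sphT (Real.pi, θ)) (n₁ (sphR (Real.pi, θ)))
      (n₂ (sphR (Real.pi, θ))) = k * Complex.exp (4 * θ * Complex.I) := by
    refine ⟨?_, fun θ => ?_⟩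
    rotate_left
    have h := hpole Real.pi θ Real.sin_pi
    simp only [twist, hg, h, toPlane_south]
    rw [show 4 * (θ : ℂ) * Complex.I = (4 : ℕ) * (θ * Complex.I) by push_cast; ring,
      Complex.exp_nat_mul, mul_pow, mul_pow, mul_mul_mul_comm, ← pow_add]
  refine no_twist (G := fun x => twist (Ψ (g x)) (sphR x) (sphS x) (sphT x) (n₁ (sphR x))
    (n₂ (sphR x))) (s₀ := 0) (s₁ := Real.pi)
    ?_ ?_ ?_ hk hk'
  · refine continuous_iff_continuousAt.2 fun x => tendsto_of_subseq_tendsto fun xs hxs => ?_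
    obtain ⟨q, hq, ψ, hψ, hlim⟩ := (D.body.1.of_isClosed_subset isClosed_frontier
      fun _ => frontier_subset D.body).tendsto_subseq (fun n => (hR (xs n)).2.1)
    have hx : Tendsto (fun n => xs (ψ n)) atTop (𝓝 x) := hxs.comp hψ.tendsto_atTop
    have hgq : q = g x := frontier_ray_tendsto D.body ho (fun n => norm_sphR _)
      ((continuous_sphR.tendsto x).comp hx) (hR x).1 (hR x).2.1 (fun n => (hR (xs (ψ n))).1)
      hq hlim
    subst hgq
    obtain ⟨φ, a₁, a₂, hφ, l₁, l₂, ha₁, ha₂, hu₁, hu₂, ha⟩ :=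
      D.exists_subseq hq (fun n => (hR (xs (ψ n))).2.1) hlim
        (fun n => (hR (xs (ψ n))).2.2.1) (fun n => (hR (xs (ψ n))).2.2.2.1)
        (fun n => (hR (xs (ψ n))).2.2.2.2)
    have hmem : ∀ n, g (xs (ψ (φ n))) ∈ frontier K := fun n => (hR _).2.1
    have hgl : Tendsto (fun n => g (xs (ψ (φ n)))) atTop (𝓝 (g x)) :=
      hlim.comp hφ.tendsto_atTop
    have hxl : Tendsto (fun n => xs (ψ (φ n))) atTop (𝓝 x) := hx.comp hφ.tendsto_atTop
    have c₁ := ConicNormal.of_tendsto D hmem hq hgl l₁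
      fun n => (hR _).2.2.1.conic (D.norm _ (hmem n))
    have c₂ := ConicNormal.of_tendsto D hmem hq hgl l₂
      fun n => (hR _).2.2.2.1.conic (D.norm _ (hmem n))
    obtain ⟨-, -, e₁, e₂, h₁₂⟩ := hR x
    refine ⟨fun n => ψ (φ n), ?_⟩
    change Tendsto _ _ (𝓝 (twist (Ψ (g x)) (sphR x) (sphS x) (sphT x) (n₁ (sphR x))
      (n₂ (sphR x))))
    rw [← twist_eq ha₁ ha₂ e₁.norm e₂.norm (ha.trans_lt D.kappa)
      (alt _ hq _ _ _ e₁ e₂ h₁₂ ha₁ hu₁ c₁) (alt _ hq _ _ _ e₁ e₂ h₁₂ ha₂ hu₂ c₂)]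
    exact tendsto_twist (D.tendsto hq hmem hgl) ((continuous_sphR.tendsto x).comp hxl)
      ((continuous_sphS.tendsto x).comp hxl) ((continuous_sphT.tendsto x).comp hxl) l₁ l₂
  · intro x
    obtain ⟨hr, hp, e₁, e₂, -⟩ := hR x
    have hu := D.norm _ hp
    have hue : 1 + ⟪Ψ (g x), sphR x⟫ ≠ 0 := by
      intro h
      have h1 : Ψ (g x) + sphR x = 0 := by
        rw [← inner_self_eq_zero (𝕜 := ℝ), inner_add_left, inner_add_right, inner_add_right,
          inner_self_one hu, inner_self_one (norm_sphR x), real_inner_comm (Ψ (g x)) (sphR x)]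
        linarith
      refine D.out _ hp _ hr ?_
      rw [eq_neg_of_add_eq_zero_left h1]
      simpa using interior_subset ho
    have key : ∀ n, EllipticNormal K Ψ (g x) n →
        toPlane (sphS x) (sphT x) (tilt (Ψ (g x)) (sphR x) n) ≠ 0 := fun n hn =>
      toPlane_sph_ne_zero x (tilt_ne_zero hn.norm hn.orth hue hu) (inner_tilt (norm_sphR x) n)
    exact mul_ne_zero (pow_ne_zero 2 (key _ e₁)) (pow_ne_zero 2 (key _ e₂))
  · intro s
    simp only [hg, hper]

end

/-- If there is an outward function `Ψ` on the boundary of a convex body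
`K` such that through every boundary point there are two elliptic sections through the
line in direction `Ψ p` making an angle at least `α`, then the boundary is an ellipsoid. -/
theorem two_elliptic_sections_outward_ellipsoid (K : Set E3) (hK : IsConvexBody K)
    (α : ℝ) (hα : 0 < α) (Ψ : E3 → E3) (hΨ : IsOutwardFunction K Ψ)
    (h : ∀ p ∈ frontier K, ∃ (H₁ H₂ : Set E3) (n₁ n₂ : E3),
      IsPlaneWithNormal H₁ n₁ ∧ IsPlaneWithNormal H₂ n₂ ∧
      H₁ ∩ H₂ = lineThrough p (Ψ p) ∧
      α ≤ Real.arccos |⟪n₁, n₂⟫| ∧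
      IsEllipse (frontier K ∩ H₁) ∧ IsEllipse (frontier K ∩ H₂)) :
    IsEllipsoid (frontier K) := by
  obtain ⟨o, ho⟩ := hK.2.2
  obtain ⟨e, he⟩ := exists_ne (0 : E3)
  obtain ⟨r, -, hr⟩ := exists_ray_frontier hK ho he
  have D := outwardData hK hα hΨ h ⟨_, hr⟩
  obtain ⟨p, hp, m, hm, hmu, hmm, hC⟩ := D.exists_three_conic
  obtain ⟨f, hf, x, hx, hfx, U, hU, hUK, hfU⟩ := exists_patch D hp hm hmu hmm hC
  exact isEllipsoid_of_quadric hK hf hx hfx (quadric_extends D hf hU hUK hfU)
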